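/- arXiv:2112.14451 — 2 statements merged into one kernel-verified Lean document; each statement's English description precedes it below -/
import Mathlib

section
/- Fix λ ≥ 0 and η > 0. Let δ(·;λ) be the convex envelope on [0,1] of the left-continuous function φ(s−;λ) = (Φ([0, w⁻¹(s))) + λ w⁻¹(s))/(1+λ), and define H*(s) = ((1+λ)/η) · δ'₊(s;λ) for s ∈ [0,1]. Then H* ∈ 𝔾 and for every H ∈ 𝔾, L(H; λ, η) ≤ L(H*; λ, η), where L(H; λ, η) = λ ∫_{[0,1)} ln H(w(u)) du + ∫_{[0,1)} ln H(w(u)) Φ(du) − η ∫_0^1 H(s) ds, valued in [−∞, ∞) with the convention that the Φ-integral equals −∞ whenever H(w(s)) = 0 for some s ∈ [0,1] with Φ([0,s]) > 0. -/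
open MeasureTheory ProbabilityTheory Set
open scoped ENNReal NNReal Classical

noncomputable section

/-- Quantile function `G_Y(z) = inf {y | F_Y(y) > z}` of `Y` under `μ`. -/
def qf {Ω : Type*} [MeasurableSpace Ω] (μ : Measure Ω) (Y : Ω → ℝ) (z : ℝ) : ℝ :=
  sInf {y : ℝ | z < (μ {ω | Y ω ≤ y}).toReal}

/-- The distorted identity `w(s) = (1/E[ξ]) ∫_0^s G_ξ(1-z) dz`. -/
def wDist {Ω : Type*} [MeasurableSpace Ω] (μ : Measure Ω) (ξ : Ω → ℝ) (s : ℝ) : ℝ :=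
  (∫ z in (0:ℝ)..s, qf μ ξ (1 - z)) / (∫ ω, ξ ω ∂μ)

/-- The inverse `w⁻¹` of `w` on `[0,1]`. -/
def wInv {Ω : Type*} [MeasurableSpace Ω] (μ : Measure Ω) (ξ : Ω → ℝ) (s : ℝ) : ℝ :=
  Function.invFunOn (wDist μ ξ) (Set.Icc 0 1) s

/-- Right derivative `δ'₊`. -/
def rtDeriv (f : ℝ → ℝ) (s : ℝ) : ℝ := derivWithin f (Set.Ioi s) s

/-- `δ` is the convex envelope of `ψ` on the set `s`: the largest convex function
on `s` that is pointwise dominated by `ψ` on `s`. -/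
def IsConvexEnvelopeOn (s : Set ℝ) (ψ δ : ℝ → ℝ) : Prop :=
  ConvexOn ℝ s δ ∧ (∀ t ∈ s, δ t ≤ ψ t) ∧
    ∀ g : ℝ → ℝ, ConvexOn ℝ s g → (∀ t ∈ s, g t ≤ ψ t) → ∀ t ∈ s, g t ≤ δ t

/-- The set `𝔾` of quantile functions of nonnegative random variables: nondecreasing on
`[0,1]`, finite and right-continuous on `[0,1)`, left-continuous at `1`. -/
def memG (H : ℝ → ℝ≥0∞) : Prop :=
  MonotoneOn H (Set.Icc 0 1) ∧ (∀ s ∈ Set.Ico (0:ℝ) 1, H s ≠ ⊤) ∧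
    (∀ s ∈ Set.Ico (0:ℝ) 1, ContinuousWithinAt H (Set.Ici s) s) ∧
    ContinuousWithinAt H (Set.Iic 1) 1

/-- Positive part of an extended real, as an `ℝ≥0∞`. -/
def erealPos (a : EReal) : ℝ≥0∞ := if a = ⊤ then ⊤ else ENNReal.ofReal a.toReal

/-- Extended integral of an `EReal`-valued function, valued in `EReal`. -/
def eIntE (ν : Measure ℝ) (f : ℝ → EReal) : EReal :=
  ((∫⁻ z, erealPos (f z) ∂ν : ℝ≥0∞) : EReal)
    - ((∫⁻ z, erealPos (-(f z)) ∂ν : ℝ≥0∞) : EReal)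

/-- The left-continuous version `φ(s−;λ) = (Φ([0, w⁻¹(s))) + λ w⁻¹(s))/(1+λ)`. -/
def phiMinus {Ω : Type*} [MeasurableSpace Ω] (μ : Measure Ω) (ξ : Ω → ℝ)
    (Φ : Measure ℝ) (lam : ℝ) (s : ℝ) : ℝ :=
  ((Φ (Set.Ico 0 (wInv μ ξ s))).toReal + lam * wInv μ ξ s) / (1 + lam)

/-- `H*(s) = ((1+λ)/η) δ'₊(s;λ)`, with the left-limit convention at `s = 1`. -/
def HstarFun (lam η : ℝ) (δ : ℝ → ℝ) (s : ℝ) : ℝ≥0∞ :=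
  if s = 1 then ⨆ t : Set.Ico (0:ℝ) 1, ENNReal.ofReal ((1 + lam) / η * rtDeriv δ (t : ℝ))
  else ENNReal.ofReal ((1 + lam) / η * rtDeriv δ s)

/-- The Lagrangian `L(H; λ, η) = λ ∫_{[0,1)} ln H(w(u)) du + ∫_{[0,1)} ln H(w(u)) Φ(du)
− η ∫_0^1 H(s) ds`, valued in `[-∞, ∞)`, with the convention that the `Φ`-integral is `-∞`
whenever `H(w(s)) = 0` for some `s ∈ [0,1]` with `Φ([0,s]) > 0`. -/
def Lfun {Ω : Type*} [MeasurableSpace Ω] (μ : Measure Ω) (ξ : Ω → ℝ) (Φ : Measure ℝ)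
    (lam η : ℝ) (H : ℝ → ℝ≥0∞) : EReal :=
  (lam : EReal) * eIntE (volume.restrict (Set.Ico 0 1))
      (fun u => ENNReal.log (H (wDist μ ξ u)))
    + (if ∃ s ∈ Set.Icc (0:ℝ) 1, H (wDist μ ξ s) = 0 ∧ 0 < Φ (Set.Icc 0 s) then (⊥ : EReal)
       else eIntE (Φ.restrict (Set.Ico 0 1)) (fun u => ENNReal.log (H (wDist μ ξ u))))
    - (η : EReal) * ((∫⁻ s in Set.Ico (0:ℝ) 1, H s : ℝ≥0∞) : EReal)

section ConvexUnitInterval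

variable {δ : ℝ → ℝ}

lemma ConvexOn.monotoneOn_of_nonneg (hc : ConvexOn ℝ (Icc 0 1) δ) (h0 : δ 0 = 0)
    (hnn : ∀ t ∈ Icc (0:ℝ) 1, 0 ≤ δ t) : MonotoneOn δ (Icc 0 1) := by
  intro x hx y hy hxy
  rcases hx.1.eq_or_lt with rfl | hx0
  · rw [h0]; exact hnn y hy
  have hy0 : 0 < y := hx0.trans_le hxy
  have h := hc.2 (left_mem_Icc.2 zero_le_one) hy
    (sub_nonneg.2 ((div_le_one hy0).2 hxy)) (div_nonneg hx0.le hy0.le) (sub_add_cancel 1 (x / y))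
  simp only [smul_eq_mul, mul_zero, zero_add, h0, div_mul_cancel₀ _ hy0.ne'] at h
  exact h.trans (mul_le_of_le_one_left (hnn y hy) ((div_le_one hy0).2 hxy))

lemma ConvexOn.comp_max_zero (hc : ConvexOn ℝ (Icc 0 1) δ) (hm : MonotoneOn δ (Icc 0 1)) :
    ConvexOn ℝ (Iic 1) (fun x => δ (max 0 x)) := by
  have himg : (fun x : ℝ => max 0 x) '' Iic 1 = Icc 0 1 := by
    ext y
    constructor
    · rintro ⟨x, hx, rfl⟩
      exact ⟨le_max_left _ _, max_le zero_le_one hx⟩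
    · rintro hy
      exact ⟨y, hy.2, max_eq_right hy.1⟩
  refine ConvexOn.comp (g := δ) (f := fun x : ℝ => max 0 x) ?_ ?_ ?_
  · rwa [himg]
  · exact (convexOn_const 0 (convex_Iic 1)).sup (convexOn_id (convex_Iic 1))
  · rwa [himg]

lemma eventuallyEq_comp_max_zero {s : ℝ} (hs : 0 ≤ s) :
    (fun x => δ (max 0 x)) =ᶠ[nhdsWithin s (Ioi s)] δ := by
  filter_upwards [self_mem_nhdsWithin] with x hx
  rw [max_eq_right (hs.trans (le_of_lt hx))]

lemma rtDeriv_comp_max_zero {s : ℝ} (hs : 0 ≤ s) :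
    rtDeriv (fun x => δ (max 0 x)) s = rtDeriv δ s :=
  (eventuallyEq_comp_max_zero hs).derivWithin_eq (by simp [max_eq_right hs])

lemma ConvexOn.hasDerivWithinAt_rtDeriv (hc : ConvexOn ℝ (Icc 0 1) δ)
    (hm : MonotoneOn δ (Icc 0 1)) {s : ℝ} (hs : s ∈ Ico (0:ℝ) 1) :
    HasDerivWithinAt δ (rtDeriv δ s) (Ioi s) s := by
  have h := (hc.comp_max_zero hm).hasDerivWithinAt_rightDeriv_of_mem_interior (x := s)
    (by simpa using hs.2)
  rw [show derivWithin (fun x => δ (max 0 x)) (Ioi s) s = rtDeriv δ s from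
    rtDeriv_comp_max_zero hs.1] at h
  exact h.congr_of_eventuallyEq (eventuallyEq_comp_max_zero hs.1).symm (by simp [max_eq_right hs.1])

lemma ConvexOn.monotoneOn_rtDeriv (hc : ConvexOn ℝ (Icc 0 1) δ) (hm : MonotoneOn δ (Icc 0 1)) :
    MonotoneOn (rtDeriv δ) (Ico 0 1) := by
  intro x hx y hy hxy
  have h := (hc.comp_max_zero hm).monotoneOn_rightDeriv (a := x) (b := y)
    (by simpa using hx.2) (by simpa using hy.2) hxy
  rwa [← rtDeriv_comp_max_zero hx.1, ← rtDeriv_comp_max_zero hy.1]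

lemma ConvexOn.rtDeriv_le_slope (hc : ConvexOn ℝ (Icc 0 1) δ) (hm : MonotoneOn δ (Icc 0 1))
    {s t : ℝ} (hs : s ∈ Ico (0:ℝ) 1) (ht : t ∈ Icc (0:ℝ) 1) (hst : s < t) :
    rtDeriv δ s ≤ slope δ s t :=
  hc.le_slope_of_hasDerivWithinAt_Ioi (Ico_subset_Icc_self hs) ht hst
    (hc.hasDerivWithinAt_rtDeriv hm hs)

lemma MonotoneOn.rtDeriv_nonneg (hm : MonotoneOn δ (Icc 0 1)) {s : ℝ} (hs : s ∈ Ico (0:ℝ) 1) :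
    0 ≤ rtDeriv δ s := by
  by_cases hd : DifferentiableWithinAt ℝ δ (Ioi s) s
  · have h := (hasDerivWithinAt_iff_tendsto_slope' self_notMem_Ioi).mp hd.hasDerivWithinAt
    refine ge_of_tendsto h ?_
    filter_upwards [Ioo_mem_nhdsGT hs.2] with t ht
    rw [slope_def_field]
    exact div_nonneg (sub_nonneg.2 (hm (Ico_subset_Icc_self hs) ⟨hs.1.trans ht.1.le, ht.2.le⟩
      ht.1.le)) (sub_nonneg.2 ht.1.le)
  · exact (derivWithin_zero_of_not_differentiableWithinAt hd).ge

lemma ConvexOn.continuousWithinAt_rtDeriv (hc : ConvexOn ℝ (Icc 0 1) δ)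
    (hm : MonotoneOn δ (Icc 0 1)) {s : ℝ}
    (hs : s ∈ Ico (0:ℝ) 1) : ContinuousWithinAt (rtDeriv δ) (Ici s) s := by
  rw [← continuousWithinAt_Ioi_iff_Ici]
  refine tendsto_order.2 ⟨fun a ha => ?_, fun a ha => ?_⟩
  · filter_upwards [Ioo_mem_nhdsGT hs.2] with t ht
    exact ha.trans_le (hc.monotoneOn_rtDeriv hm hs ⟨hs.1.trans ht.1.le, ht.2⟩ ht.1.le)
  · have hsl := (hasDerivWithinAt_iff_tendsto_slope' self_notMem_Ioi).mp
      (hc.hasDerivWithinAt_rtDeriv hm hs)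
    obtain ⟨u, hua, hu⟩ := ((hsl.eventually (gt_mem_nhds ha)).and (Ioo_mem_nhdsGT hs.2)).exists
    have hu1 : u ∈ Icc (0:ℝ) 1 := ⟨hs.1.trans hu.1.le, hu.2.le⟩
    have hδs : Filter.Tendsto δ (nhdsWithin s (Ioi s)) (nhds (δ s)) :=
      (hc.hasDerivWithinAt_rtDeriv hm hs).continuousWithinAt
    have hslope : Filter.Tendsto (fun t => (δ u - δ t) / (u - t)) (nhdsWithin s (Ioi s))
        (nhds ((δ u - δ s) / (u - s))) := by
      refine (tendsto_const_nhds.sub hδs).div (tendsto_const_nhds.sub ?_) (sub_pos.2 hu.1).ne'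
      exact tendsto_nhdsWithin_of_tendsto_nhds Filter.tendsto_id
    rw [slope_def_field] at hua
    filter_upwards [hslope.eventually (gt_mem_nhds hua), Ioo_mem_nhdsGT hu.1] with t hta ht
    have := hc.rtDeriv_le_slope hm (s := t) ⟨hs.1.trans ht.1.le, ht.2.trans hu.2⟩ hu1 ht.2
    rw [slope_def_field] at this
    exact this.trans_lt hta

lemma ConvexOn.setLIntegral_rtDeriv (hc : ConvexOn ℝ (Icc 0 1) δ)
    (hm : MonotoneOn δ (Icc 0 1)) (hcont : ContinuousOn δ (Icc 0 1)) {a b : ℝ}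
    (ha : 0 ≤ a) (hab : a ≤ b) (hb : b ≤ 1) :
    ∫⁻ s in Ioo a b, ENNReal.ofReal (rtDeriv δ s) = ENNReal.ofReal (δ b - δ a) := by
  have hsub : Icc a b ⊆ Icc 0 1 := Icc_subset_Icc ha hb
  have hmem : ∀ x ∈ Ioo a b, x ∈ Ico (0:ℝ) 1 := fun x hx =>
    ⟨ha.trans hx.1.le, hx.2.trans_le hb⟩
  have hd : ∀ x ∈ Ioo a b, HasDerivWithinAt δ (rtDeriv δ x) (Ioi x) x := fun x hx =>
    hc.hasDerivWithinAt_rtDeriv hm (hmem x hx)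
  have hint := intervalIntegral.integrableOn_deriv_right_of_nonneg (hcont.mono hsub) hd
    (fun x hx => hm.rtDeriv_nonneg (hmem x hx))
  rw [← intervalIntegral.integral_eq_sub_of_hasDeriv_right_of_le hab (hcont.mono hsub) hd
    ((intervalIntegrable_iff_integrableOn_Ioc_of_le hab).2 hint),
    intervalIntegral.integral_of_le hab, integral_Ioc_eq_integral_Ioo,
    ofReal_integral_eq_lintegral_ofReal (hint.mono_set Ioo_subset_Ioc_self)]
  filter_upwards [ae_restrict_mem measurableSet_Ioo] with x hx using hm.rtDeriv_nonneg (hmem x hx)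

end ConvexUnitInterval

lemma measureReal_Ico_le_of_forall_lt {M : Measure ℝ} [IsFiniteMeasure M] {a b x : ℝ} (hab : a < b)
    (h : ∀ p ∈ Ico a b, M.real (Ico a p) ≤ x) : M.real (Ico a b) ≤ x := by
  obtain ⟨u, hu, hub, hlim⟩ := exists_seq_strictMono_tendsto' hab
  have hU : ⋃ n, Ico a (u n) = Ico a b := by
    ext y
    simp only [mem_iUnion, mem_Ico]
    constructor
    · rintro ⟨n, hy, hyn⟩
      exact ⟨hy, hyn.trans (hub n).2⟩
    · rintro ⟨hy, hyb⟩
      obtain ⟨n, hn⟩ := (hlim.eventually (lt_mem_nhds hyb)).exists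
      exact ⟨n, hy, hn⟩
  have ht := tendsto_measure_iUnion_atTop (μ := M) (s := fun n => Ico a (u n))
    (fun i j hij => Ico_subset_Ico_right (hu.monotone hij))
  rw [hU] at ht
  refine le_of_tendsto ((ENNReal.tendsto_toReal (measure_ne_top M _)).comp ht) ?_
  exact Filter.Eventually.of_forall fun n => h _ ⟨(hub n).1.le, (hub n).2⟩

namespace IsConvexEnvelopeOn

variable {M : Measure ℝ} {δ : ℝ → ℝ}

lemma nonneg (h : IsConvexEnvelopeOn (Icc 0 1) (fun t => M.real (Ico 0 t)) δ) :
    ∀ t ∈ Icc (0:ℝ) 1, 0 ≤ δ t :=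
  h.2.2 (fun _ => 0) (convexOn_const 0 (convex_Icc 0 1)) fun _ _ => measureReal_nonneg

lemma apply_zero (h : IsConvexEnvelopeOn (Icc 0 1) (fun t => M.real (Ico 0 t)) δ) : δ 0 = 0 :=
  le_antisymm (by simpa using h.2.1 0 (by simp)) (h.nonneg 0 (by simp))

lemma monotoneOn (h : IsConvexEnvelopeOn (Icc 0 1) (fun t => M.real (Ico 0 t)) δ) :
    MonotoneOn δ (Icc 0 1) :=
  h.1.monotoneOn_of_nonneg h.apply_zero h.nonneg

variable [IsFiniteMeasure M]

lemma ramp_le (h : IsConvexEnvelopeOn (Icc 0 1) (fun t => M.real (Ico 0 t)) δ) {p : ℝ}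
    (hp : p ∈ Ico (0:ℝ) 1) {s : ℝ} (hs : s ∈ Icc (0:ℝ) 1) :
    M.real (Ico 0 p) * ((s - p) / (1 - p)) ≤ δ s := by
  have hp1 : 0 < 1 - p := sub_pos.2 hp.2
  have hc : ConvexOn ℝ (Icc (0:ℝ) 1)
      ((fun _ => 0) ⊔ fun s => M.real (Ico 0 p) * ((s - p) / (1 - p))) := by
    refine (convexOn_const 0 (convex_Icc 0 1)).sup ⟨convex_Icc 0 1, fun x _ y _ a b _ _ hab => ?_⟩
    obtain rfl : a = 1 - b := by linarith
    simp only [smul_eq_mul]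
    apply le_of_eq
    field_simp
    ring
  refine le_trans (le_max_right _ _) (h.2.2 _ hc (fun t ht => ?_) s hs)
  refine max_le measureReal_nonneg ?_
  rcases le_total t p with htp | htp
  · refine (mul_nonpos_of_nonneg_of_nonpos measureReal_nonneg ?_).trans measureReal_nonneg
    exact div_nonpos_of_nonpos_of_nonneg (sub_nonpos.2 htp) hp1.le
  · calc M.real (Ico 0 p) * ((t - p) / (1 - p)) ≤ M.real (Ico 0 p) * 1 := by
          gcongr
          rw [div_le_one hp1]
          linarith [ht.2]
      _ ≤ M.real (Ico 0 t) := by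
          rw [mul_one]
          exact measureReal_mono (Ico_subset_Ico_right htp)

lemma apply_one (h : IsConvexEnvelopeOn (Icc 0 1) (fun t => M.real (Ico 0 t)) δ) :
    δ 1 = M.real (Ico 0 1) := by
  refine le_antisymm (h.2.1 1 (by simp)) (measureReal_Ico_le_of_forall_lt one_pos fun p hp => ?_)
  have := h.ramp_le hp (right_mem_Icc.2 zero_le_one)
  rwa [div_self (sub_pos.2 hp.2).ne', mul_one] at this

lemma continuousOn (h : IsConvexEnvelopeOn (Icc 0 1) (fun t => M.real (Ico 0 t)) δ) :
    ContinuousOn δ (Icc 0 1) := by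
  have hI : ContinuousOn (fun x => δ (max 0 x)) (Iio 1) := by
    have := (h.1.comp_max_zero h.monotoneOn).continuousOn_interior
    rwa [interior_Iic] at this
  intro s hs
  rcases hs.2.lt_or_eq with hs1 | rfl
  · have h1 := (hI.continuousAt (Iio_mem_nhds hs1)).continuousWithinAt (s := Icc 0 1)
    exact h1.congr (fun y hy => by rw [max_eq_right hy.1]) (by rw [max_eq_right hs.1])
  · refine tendsto_order.2 ⟨fun a ha => ?_, fun a ha => ?_⟩
    · rw [h.apply_one] at ha
      obtain ⟨p, hp, hap⟩ : ∃ p ∈ Ico (0:ℝ) 1, a < M.real (Ico 0 p) := by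
        by_contra! hcon
        exact ha.not_ge (measureReal_Ico_le_of_forall_lt one_pos hcon)
      have hlim : Filter.Tendsto (fun s => M.real (Ico 0 p) * ((s - p) / (1 - p)))
          (nhdsWithin 1 (Icc 0 1)) (nhds (M.real (Ico 0 p) * ((1 - p) / (1 - p)))) := by
        apply tendsto_nhdsWithin_of_tendsto_nhds
        apply Continuous.tendsto
        fun_prop
      rw [div_self (sub_pos.2 hp.2).ne', mul_one] at hlim
      filter_upwards [hlim.eventually (lt_mem_nhds hap), self_mem_nhdsWithin] with t hta ht
      exact hta.trans_le (h.ramp_le hp ht)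
    · filter_upwards [self_mem_nhdsWithin] with t ht
      exact (h.monotoneOn ht hs ht.2).trans_lt ha

lemma eq_of_rtDeriv_lt (h : IsConvexEnvelopeOn (Icc 0 1) (fun t => M.real (Ico 0 t)) δ) {b : ℝ}
    (hb : b ∈ Ioo (0:ℝ) 1) (hlt : ∀ p ∈ Ico 0 b, rtDeriv δ p < rtDeriv δ b) :
    δ b = M.real (Ico 0 b) := by
  refine le_antisymm (h.2.1 b (Ioo_subset_Icc_self hb)) ?_
  refine measureReal_Ico_le_of_forall_lt hb.1 fun p hp => ?_
  by_contra! hpb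
  have hbI : b ∈ Icc (0:ℝ) 1 := Ioo_subset_Icc_self hb
  have hpI : p ∈ Icc (0:ℝ) 1 := ⟨hp.1, hp.2.le.trans hb.2.le⟩
  obtain ⟨q, hqp, hq⟩ : ∃ q, δ q < M.real (Ico 0 p) ∧ q ∈ Ioo b 1 := by
    have hcb : Filter.Tendsto δ (nhdsWithin b (Ioi b)) (nhds (δ b)) :=
      (h.continuousOn.continuousAt (Icc_mem_nhds hb.1 hb.2)).continuousWithinAt
    exact ((hcb.eventually (gt_mem_nhds hpb)).and (Ioo_mem_nhdsGT hb.2)).exists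
  have hqI : q ∈ Icc (0:ℝ) 1 := ⟨hb.1.le.trans hq.1.le, hq.2.le⟩
  have hpq : p < q := hp.2.trans hq.1
  set k := (δ q - δ p) / (q - p) with hk
  have hk0 : 0 ≤ k := div_nonneg (sub_nonneg.2 (h.monotoneOn hpI hqI hpq.le)) (sub_nonneg.2 hpq.le)
  have hkq : δ p + k * (q - p) = δ q := by
    rw [hk, div_mul_cancel₀ _ (sub_pos.2 hpq).ne']; ring
  have hc : ConvexOn ℝ (Icc (0:ℝ) 1) (δ ⊔ fun s => δ p + k * (s - p)) := by
    refine h.1.sup ⟨convex_Icc 0 1, fun x _ y _ a b _ _ hab => ?_⟩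
    obtain rfl : a = 1 - b := by linarith
    simp only [smul_eq_mul]
    apply le_of_eq
    ring
  have hle := h.2.2 _ hc fun t ht => by
    refine max_le (h.2.1 t ht) ?_
    change δ p + k * (t - p) ≤ M.real (Ico 0 t)
    rcases lt_or_ge t p with htp | htp
    · refine le_trans ?_ (h.2.1 t ht)
      have := h.1.secant_mono hpI ht hqI htp.ne hpq.ne' (htp.trans hpq).le
      rw [← hk, div_le_iff_of_neg (by linarith)] at this
      linarith
    rcases le_or_gt t q with htq | htq
    · calc δ p + k * (t - p) ≤ δ p + k * (q - p) := by gcongr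
        _ ≤ M.real (Ico 0 p) := by rw [hkq]; exact hqp.le
        _ ≤ M.real (Ico 0 t) := measureReal_mono (Ico_subset_Ico_right htp)
    · refine le_trans ?_ (h.2.1 t ht)
      have := h.1.secant_mono hpI hqI ht hpq.ne' (hpq.trans htq).ne' htq.le
      rw [← hk, le_div_iff₀ (by linarith)] at this
      linarith
  have heq : ∀ t ∈ Icc p q, δ t = δ p + k * (t - p) := fun t ht => by
    have htI : t ∈ Icc (0:ℝ) 1 := ⟨hp.1.trans ht.1, ht.2.trans hq.2.le⟩
    refine le_antisymm ?_ ((le_max_right _ _).trans (hle t htI))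
    rcases ht.1.eq_or_lt with rfl | hpt
    · simp
    have := h.1.secant_mono hpI htI hqI hpt.ne' hpq.ne' ht.2
    rw [← hk, div_le_iff₀ (by linarith)] at this
    linarith
  have hder : ∀ t ∈ Ico p q, rtDeriv δ t = k := fun t ht => by
    have hd : HasDerivWithinAt (fun s => δ p + k * (s - p)) k (Ioi t) t := by
      simpa using (((hasDerivAt_id t).sub_const p).const_mul k |>.const_add (δ p)).hasDerivWithinAt
    refine (hd.congr_of_eventuallyEq ?_ (heq t ⟨ht.1, ht.2.le⟩)).derivWithin
      (uniqueDiffWithinAt_Ioi t)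
    filter_upwards [Ioo_mem_nhdsGT ht.2] with s hs using heq s ⟨ht.1.trans hs.1.le, hs.2.le⟩
  have := hlt p hp
  rw [hder p ⟨le_rfl, hpq⟩, hder b ⟨hp.2.le, hq.1⟩] at this
  exact this.false


lemma exists_contact (h : IsConvexEnvelopeOn (Icc 0 1) (fun t => M.real (Ico 0 t)) δ) (z : ℝ) :
    ∃ b ∈ Icc (0:ℝ) 1, {s ∈ Ico (0:ℝ) 1 | rtDeriv δ s < z} = Ico 0 b ∧
      δ b = M.real (Ico 0 b) := by
  by_cases hA : ∀ s ∈ Ico (0:ℝ) 1, rtDeriv δ s < z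
  · exact ⟨1, by simp, by ext s; exact ⟨fun hs => hs.1, fun hs => ⟨hs, hA s hs⟩⟩, h.apply_one⟩
  push Not at hA
  have hmono := h.1.monotoneOn_rtDeriv h.monotoneOn
  set A : Set ℝ := {s ∈ Ico (0:ℝ) 1 | z ≤ rtDeriv δ s} with hAdef
  have hne : A.Nonempty := hA
  have hbdd : BddBelow A := ⟨0, fun s hs => hs.1.1⟩
  have hb : sInf A ∈ Ico (0:ℝ) 1 := by
    obtain ⟨a, ha⟩ := hne
    exact ⟨le_csInf ⟨a, ha⟩ fun s hs => hs.1.1, (csInf_le hbdd ha).trans_lt ha.1.2⟩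
  have hlow : ∀ p ∈ Ico 0 (sInf A), rtDeriv δ p < z := fun p hp => by
    by_contra! hcon
    exact (csInf_le hbdd ⟨⟨hp.1, hp.2.trans hb.2⟩, hcon⟩).not_gt hp.2
  have hbz : z ≤ rtDeriv δ (sInf A) := by
    by_contra! hcon
    have hev := (h.1.continuousWithinAt_rtDeriv h.monotoneOn hb).eventually (gt_mem_nhds hcon)
    obtain ⟨u, hu, hsub⟩ := mem_nhdsGE_iff_exists_Ico_subset.1 hev
    obtain ⟨a, ha, hau⟩ := exists_lt_of_csInf_lt hne hu
    exact (hsub ⟨csInf_le hbdd ha, hau⟩ : rtDeriv δ a < z).not_ge ha.2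
  refine ⟨sInf A, Ico_subset_Icc_self hb, ?_, ?_⟩
  · ext s
    refine ⟨fun hs => ⟨hs.1.1, ?_⟩, fun hs => ⟨⟨hs.1, hs.2.trans hb.2⟩, hlow s hs⟩⟩
    by_contra! hcon
    exact (hbz.trans (hmono hb hs.1 hcon)).not_gt hs.2
  · rcases hb.1.eq_or_lt with h0 | h0
    · rw [← h0, h.apply_zero]; simp
    · exact h.eq_of_rtDeriv_lt ⟨h0, hb.2⟩ fun p hp => (hlow p hp).trans_le hbz

lemma measure_inter_le (h : IsConvexEnvelopeOn (Icc 0 1) (fun t => M.real (Ico 0 t)) δ)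
    {U : Set ℝ} (hU : U ⊆ Ico 0 1) (hup : ∀ x ∈ U, ∀ y ∈ Ico (0:ℝ) 1, x ≤ y → y ∈ U)
    {b : ℝ} (hb : b ∈ Icc (0:ℝ) 1) (hδb : δ b = M.real (Ico 0 b)) :
    M (U ∩ Ico 0 b) ≤ ∫⁻ s in U ∩ Ico 0 b, ENNReal.ofReal (rtDeriv δ s) := by
  rcases (U ∩ Ico 0 b).eq_empty_or_nonempty with he | ⟨u, hu⟩
  · simp [he]
  have hbdd : BddBelow U := ⟨0, fun s hs => (hU hs).1⟩
  have ha0 : 0 ≤ sInf U := le_csInf ⟨u, hu.1⟩ fun s hs => (hU hs).1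
  have hab : sInf U ≤ b := (csInf_le hbdd hu.1).trans hu.2.2.le
  have haI : sInf U ∈ Icc (0:ℝ) 1 := ⟨ha0, hab.trans hb.2⟩
  have hsplit : M.real (Ico 0 b) = M.real (Ico 0 (sInf U)) + M.real (Ico (sInf U) b) := by
    rw [← Ico_union_Ico_eq_Ico ha0 hab]
    exact measureReal_union (Ico_disjoint_Ico_same) measurableSet_Ico
  calc M (U ∩ Ico 0 b) ≤ M (Ico (sInf U) b) :=
        measure_mono fun s hs => ⟨csInf_le hbdd hs.1, hs.2.2⟩
    _ = ENNReal.ofReal (M.real (Ico (sInf U) b)) := (ofReal_measureReal).symm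
    _ ≤ ENNReal.ofReal (δ b - δ (sInf U)) := by
        apply ENNReal.ofReal_le_ofReal
        have := h.2.1 _ haI
        simp only at this
        linarith
    _ = ∫⁻ s in Ioo (sInf U) b, ENNReal.ofReal (rtDeriv δ s) :=
        (h.1.setLIntegral_rtDeriv h.monotoneOn h.continuousOn ha0 hab hb.2).symm
    _ ≤ ∫⁻ s in U ∩ Ico 0 b, ENNReal.ofReal (rtDeriv δ s) := by
        refine lintegral_mono_set fun s hs => ?_
        obtain ⟨a, ha, has⟩ := exists_lt_of_csInf_lt ⟨u, hu.1⟩ hs.1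
        have hs0 : 0 ≤ s := ha0.trans hs.1.le
        exact ⟨hup a ha s ⟨hs0, hs.2.trans_le hb.2⟩ has.le, hs0, hs.2⟩

lemma measure_rtDeriv_nonpos (h : IsConvexEnvelopeOn (Icc 0 1) (fun t => M.real (Ico 0 t)) δ) :
    M {s ∈ Ico (0:ℝ) 1 | rtDeriv δ s ≤ 0} = 0 := by
  refine le_antisymm (ENNReal.le_of_forall_pos_le_add fun ε hε _ => ?_) bot_le
  obtain ⟨b, hb, hset, hδb⟩ := h.exists_contact (ε : ℝ)
  have hle := h.measure_inter_le (U := Ico 0 1) subset_rfl (fun _ _ y hy _ => hy) hb hδb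
  rw [inter_eq_right.2 (Ico_subset_Ico_right hb.2)] at hle
  calc M {s ∈ Ico (0:ℝ) 1 | rtDeriv δ s ≤ 0} ≤ M (Ico 0 b) := by
        rw [← hset]
        exact measure_mono fun s hs => ⟨hs.1, hs.2.trans_lt (by exact_mod_cast hε)⟩
    _ ≤ ∫⁻ _ in Ico 0 b, (ε : ℝ≥0∞) := by
        refine hle.trans (setLIntegral_mono' measurableSet_Ico fun s hs => ?_)
        rw [← hset] at hs
        rw [← ENNReal.ofReal_coe_nnreal]
        exact ENNReal.ofReal_le_ofReal hs.2.le
    _ ≤ 0 + ε := by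
        rw [setLIntegral_const, Real.volume_Ico, zero_add]
        exact mul_le_of_le_one_right bot_le (by simpa using hb.2)

end IsConvexEnvelopeOn

lemma lintegral_mul_le_of_measure_superlevel_le {α : Type*} [MeasurableSpace α] {M D : Measure α}
    [SFinite M] [SFinite D] {f g : α → ℝ} (hf : 0 ≤ᵐ[M] f) (hf' : 0 ≤ᵐ[D] f)
    (hg : 0 ≤ᵐ[M] g) (hg' : 0 ≤ᵐ[D] g) (hfM : AEMeasurable f M) (hfD : AEMeasurable f D)
    (hgM : AEMeasurable g M) (hgD : AEMeasurable g D)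
    (h : ∀ x > 0, ∀ y > 0, M {a | x ≤ f a ∧ y < g a} ≤ D {a | x ≤ f a ∧ y < g a}) :
    ∫⁻ a, ENNReal.ofReal (g a) * ENNReal.ofReal (f a) ∂M
      ≤ ∫⁻ a, ENNReal.ofReal (g a) * ENNReal.ofReal (f a) ∂D := by
  have key : ∀ (N : Measure α) [SFinite N], 0 ≤ᵐ[N] f → 0 ≤ᵐ[N] g → AEMeasurable f N →
      AEMeasurable g N → ∫⁻ a, ENNReal.ofReal (g a) * ENNReal.ofReal (f a) ∂N
        = ∫⁻ x in Ioi 0, ∫⁻ y in Ioi 0, N {a | x ≤ f a ∧ y < g a} := by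
    intro N _ hf hg hfm hgm
    have hac := withDensity_absolutelyContinuous N fun a => ENNReal.ofReal (g a)
    have h1 := lintegral_withDensity_eq_lintegral_mul₀ hgm.ennreal_ofReal hfm.ennreal_ofReal
    simp only [Pi.mul_apply] at h1
    rw [← h1, lintegral_eq_lintegral_meas_le _ (hac.ae_le hf) (hfm.mono_ac hac)]
    refine lintegral_congr fun x => ?_
    rw [withDensity_apply', lintegral_eq_lintegral_meas_lt _ (ae_restrict_of_ae hg) hgm.restrict]
    refine lintegral_congr fun y => ?_
    rw [Measure.restrict_apply₀ (nullMeasurableSet_lt aemeasurable_const hgm.restrict)]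
    congr 1
    ext a
    simp [and_comm]
  rw [key M hf hg hfM hgM, key D hf' hg' hfD hgD]
  exact setLIntegral_mono' measurableSet_Ioi fun x hx =>
    setLIntegral_mono' measurableSet_Ioi fun y hy => h x hx y hy

lemma IsConvexEnvelopeOn.lintegral_div_rtDeriv_le {M : Measure ℝ} [IsFiniteMeasure M] {δ : ℝ → ℝ}
    (h : IsConvexEnvelopeOn (Icc 0 1) (fun t => M.real (Ico 0 t)) δ) {H : ℝ → ℝ≥0∞}
    (hH : MonotoneOn H (Ico 0 1)) (hfin : ∀ s ∈ Ico (0:ℝ) 1, H s ≠ ⊤) :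
    ∫⁻ s in Ico 0 1, H s / ENNReal.ofReal (rtDeriv δ s) ∂M ≤ ∫⁻ s in Ico 0 1, H s := by
  have hmono := h.1.monotoneOn_rtDeriv h.monotoneOn
  have hfmono : MonotoneOn (fun s => (H s).toReal) (Ico 0 1) := fun x hx y hy hxy =>
    ENNReal.toReal_mono (hfin y hy) (hH hx hy hxy)
  set D := (volume.restrict (Ico (0:ℝ) 1)).withDensity fun s => ENNReal.ofReal (rtDeriv δ s) with hD
  have hDac : D ≪ volume.restrict (Ico (0:ℝ) 1) := withDensity_absolutelyContinuous _ _
  have hm {N : Measure ℝ} {f : ℝ → ℝ} (hf : MonotoneOn f (Ico 0 1)) :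
      AEMeasurable f (N.restrict (Ico 0 1)) :=
    aemeasurable_restrict_of_monotoneOn measurableSet_Ico hf
  have hnn {N : Measure ℝ} : 0 ≤ᵐ[N.restrict (Ico 0 1)] fun s => (rtDeriv δ s)⁻¹ := by
    filter_upwards [ae_restrict_mem measurableSet_Ico] with s hs
    exact inv_nonneg.2 (h.monotoneOn.rtDeriv_nonneg hs)
  have hle := lintegral_mul_le_of_measure_superlevel_le (M := M.restrict (Ico 0 1)) (D := D)
    (f := fun s => (H s).toReal) (g := fun s => (rtDeriv δ s)⁻¹)
    (ae_of_all _ fun _ => ENNReal.toReal_nonneg) (ae_of_all _ fun _ => ENNReal.toReal_nonneg)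
    hnn (hDac.ae_le hnn) (hm hfmono) ((hm hfmono).mono_ac hDac) (hm hmono).inv
    ((hm hmono).inv.mono_ac hDac) ?_
  · refine le_trans (le_of_eq ?_) (hle.trans ?_)
    · refine lintegral_congr_ae ?_
      have hpos : ∀ᵐ s ∂M.restrict (Ico 0 1), 0 < rtDeriv δ s := by
        rw [ae_restrict_iff' measurableSet_Ico, ae_iff]
        convert h.measure_rtDeriv_nonpos using 2
        ext s
        simp [and_assoc]
      filter_upwards [hpos, ae_restrict_mem measurableSet_Ico] with s hs hsI
      rw [ENNReal.ofReal_inv_of_pos hs, ENNReal.ofReal_toReal (hfin s hsI), mul_comm,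
        ENNReal.div_eq_inv_mul, mul_comm]
    · have h1 := lintegral_withDensity_eq_lintegral_mul₀ (hm (N := volume) hmono).ennreal_ofReal
        ((hm (N := volume) hmono).inv.ennreal_ofReal.mul
          (hm (N := volume) hfmono).ennreal_ofReal)
      simp only [Pi.mul_apply, Pi.inv_apply] at h1
      rw [hD, h1]
      refine setLIntegral_mono' measurableSet_Ico fun s hs => ?_
      rw [ENNReal.ofReal_toReal (hfin s hs), ← mul_assoc,
        ← ENNReal.ofReal_mul (h.monotoneOn.rtDeriv_nonneg hs)]
      exact mul_le_of_le_one_left bot_le (ENNReal.ofReal_le_one.2 mul_inv_le_one)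
  · intro x hx y hy
    obtain ⟨b, hb, hset, hδb⟩ := h.exists_contact y⁻¹
    have hU := h.measure_inter_le (U := {s ∈ Ico (0:ℝ) 1 | x ≤ (H s).toReal ∧ 0 < rtDeriv δ s})
      (fun s hs => hs.1) (fun s hs t ht hst => ⟨ht, hs.2.1.trans (hfmono hs.1 ht hst),
        hs.2.2.trans_le (hmono hs.1 ht hst)⟩) hb hδb
    have hS : {s ∈ Ico (0:ℝ) 1 | x ≤ (H s).toReal ∧ 0 < rtDeriv δ s} ∩ Ico 0 b
        = {s | x ≤ (H s).toReal ∧ y < (rtDeriv δ s)⁻¹} ∩ Ico 0 1 := by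
      rw [← hset]
      ext s
      simp only [mem_inter_iff, mem_ofPred_eq]
      constructor
      · rintro ⟨⟨hs, hx, h0⟩, -, hlt⟩
        exact ⟨⟨hx, (lt_inv_comm₀ h0 hy).1 hlt⟩, hs⟩
      · rintro ⟨⟨hx, hlt⟩, hs⟩
        have h0 : 0 < rtDeriv δ s := inv_pos.1 (lt_trans hy hlt)
        exact ⟨⟨hs, hx, h0⟩, hs, (lt_inv_comm₀ hy h0).1 hlt⟩
    rw [hS] at hU
    rwa [Measure.restrict_apply' measurableSet_Ico, withDensity_apply',
      Measure.restrict_restrict' measurableSet_Ico]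

section QuantileIntegral

variable {Ω : Type*} [MeasurableSpace Ω] {μ : Measure Ω} {ξ : Ω → ℝ}

lemma wDist_zero : wDist μ ξ 0 = 0 := by simp [wDist]

variable [IsProbabilityMeasure μ]

lemma toReal_measure_le_eq_cdf (hξm : Measurable ξ) (y : ℝ) :
    (μ {ω | ξ ω ≤ y}).toReal = cdf (μ.map ξ) y := by
  have := Measure.isProbabilityMeasure_map (μ := μ) hξm.aemeasurable
  rw [cdf_eq_real, measureReal_def, Measure.map_apply hξm measurableSet_Iic]
  rfl

lemma qf_eq (hξm : Measurable ξ) (z : ℝ) : qf μ ξ z = sInf {y | z < cdf (μ.map ξ) y} := by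
  simp only [qf, toReal_measure_le_eq_cdf hξm]

lemma cdf_map_zero_of_pos (hξm : Measurable ξ) (hξpos : ∀ ω, 0 < ξ ω) : cdf (μ.map ξ) 0 = 0 := by
  rw [← toReal_measure_le_eq_cdf hξm]
  have : {ω | ξ ω ≤ 0} = ∅ := by
    ext ω
    simpa using hξpos ω
  simp [this]

lemma nonempty_lt_cdf (ν : Measure ℝ) {z : ℝ} (hz : z < 1) : {y | z < cdf ν y}.Nonempty :=
  ((tendsto_cdf_atTop ν).eventually (lt_mem_nhds hz)).exists

lemma pos_of_lt_cdf (hξm : Measurable ξ) (hξpos : ∀ ω, 0 < ξ ω) {y z : ℝ} (hz : 0 < z)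
    (hy : z < cdf (μ.map ξ) y) : 0 < y := by
  by_contra! hcon
  have := monotone_cdf (μ.map ξ) hcon
  rw [cdf_map_zero_of_pos hξm hξpos] at this
  linarith

lemma bddBelow_lt_cdf (hξm : Measurable ξ) (hξpos : ∀ ω, 0 < ξ ω) {z : ℝ} (hz : 0 < z) :
    BddBelow {y | z < cdf (μ.map ξ) y} :=
  ⟨0, fun _ hy => (pos_of_lt_cdf hξm hξpos hz hy).le⟩

lemma qf_pos (hξm : Measurable ξ) (hξpos : ∀ ω, 0 < ξ ω) {z : ℝ} (hz : z ∈ Ioo (0:ℝ) 1) :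
    0 < qf μ ξ z := by
  rw [qf_eq hξm]
  have hrc := (cdf (μ.map ξ)).right_continuous 0
  have hev := hrc.eventually (gt_mem_nhds (by rw [cdf_map_zero_of_pos hξm hξpos]; exact hz.1))
  obtain ⟨u, hu, hsub⟩ := mem_nhdsGE_iff_exists_Ico_subset.1 hev
  refine lt_of_lt_of_le hu (le_csInf (nonempty_lt_cdf _ hz.2) fun y hy => ?_)
  by_contra! hcon
  have hy' : z < cdf (μ.map ξ) y := hy
  exact hy'.not_gt (hsub ⟨(pos_of_lt_cdf hξm hξpos hz.1 hy).le, hcon⟩)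

lemma monotoneOn_qf (hξm : Measurable ξ) (hξpos : ∀ ω, 0 < ξ ω) :
    MonotoneOn (qf μ ξ) (Ioo 0 1) := by
  intro x hx y hy hxy
  rw [qf_eq hξm, qf_eq hξm]
  exact csInf_le_csInf (bddBelow_lt_cdf hξm hξpos hx.1) (nonempty_lt_cdf _ hy.2)
    fun t ht => hxy.trans_lt ht

lemma aemeasurable_qf (hξm : Measurable ξ) (hξpos : ∀ ω, 0 < ξ ω) :
    AEMeasurable (qf μ ξ) (volume.restrict (Ioo 0 1)) :=
  aemeasurable_restrict_of_monotoneOn measurableSet_Ioo (monotoneOn_qf hξm hξpos)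

lemma map_qf (hξm : Measurable ξ) (hξpos : ∀ ω, 0 < ξ ω) :
    (volume.restrict (Ioo (0:ℝ) 1)).map (qf μ ξ) = μ.map ξ := by
  have := Measure.isProbabilityMeasure_map (μ := μ) hξm.aemeasurable
  refine Measure.ext_of_Iic _ _ fun y => ?_
  rw [Measure.map_apply_of_aemeasurable (aemeasurable_qf hξm hξpos) measurableSet_Iic,
    Measure.restrict_apply' measurableSet_Ioo, ← ofReal_cdf]
  have h1 : cdf (μ.map ξ) y ≤ 1 := cdf_le_one _ y
  refine le_antisymm ?_ ?_
  · calc volume (qf μ ξ ⁻¹' Iic y ∩ Ioo 0 1) ≤ volume (Ioc 0 (cdf (μ.map ξ) y)) := by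
          refine measure_mono fun z hz => ⟨hz.2.1, ?_⟩
          have hzy : sInf {y | z < cdf (μ.map ξ) y} ≤ y := by
            rw [← qf_eq hξm]; exact hz.1
          refine ge_of_tendsto (((cdf (μ.map ξ)).right_continuous y).mono Ioi_subset_Ici_self) ?_
          filter_upwards [self_mem_nhdsWithin] with t ht
          obtain ⟨a, ha, hat⟩ := exists_lt_of_csInf_lt (nonempty_lt_cdf _ hz.2.2) (hzy.trans_lt ht)
          exact ha.le.trans (monotone_cdf _ hat.le)
      _ = _ := by rw [Real.volume_Ioc, sub_zero]
  · calc ENNReal.ofReal (cdf (μ.map ξ) y) = volume (Ioo 0 (cdf (μ.map ξ) y)) := by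
          rw [Real.volume_Ioo, sub_zero]
      _ ≤ _ := by
          refine measure_mono fun z hz => ⟨?_, hz.1, hz.2.trans_le h1⟩
          change qf μ ξ z ≤ y
          rw [qf_eq hξm]
          exact csInf_le (bddBelow_lt_cdf hξm hξpos hz.1) hz.2

lemma integrableOn_qf (hξm : Measurable ξ) (hξpos : ∀ ω, 0 < ξ ω) (hξint : Integrable ξ μ) :
    IntegrableOn (qf μ ξ) (Ioo 0 1) := by
  have h : Integrable id (μ.map ξ) :=
    (integrable_map_measure aestronglyMeasurable_id hξm.aemeasurable).2 hξint
  rw [← map_qf hξm hξpos] at h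
  exact (integrable_map_measure aestronglyMeasurable_id (aemeasurable_qf hξm hξpos)).1 h

lemma intervalIntegral_qf (hξm : Measurable ξ) (hξpos : ∀ ω, 0 < ξ ω) :
    ∫ z in (0:ℝ)..1, qf μ ξ z = ∫ ω, ξ ω ∂μ := by
  have h1 := integral_map (f := id) hξm.aemeasurable (aestronglyMeasurable_id (μ := μ.map ξ))
  have h2 := integral_map (f := id) (aemeasurable_qf (μ := μ) hξm hξpos) aestronglyMeasurable_id
  rw [map_qf hξm hξpos, h1] at h2
  rw [intervalIntegral.integral_of_le zero_le_one, integral_Ioc_eq_integral_Ioo]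
  exact h2.symm

lemma intervalIntegrable_qf_sub (hξm : Measurable ξ) (hξpos : ∀ ω, 0 < ξ ω)
    (hξint : Integrable ξ μ) : IntervalIntegrable (fun z => qf μ ξ (1 - z)) volume 0 1 := by
  have h : IntervalIntegrable (qf μ ξ) volume 0 1 :=
    (intervalIntegrable_iff_integrableOn_Ioo_of_le zero_le_one).2 (integrableOn_qf hξm hξpos hξint)
  simpa using (h.comp_sub_left 1).symm

lemma integral_pos_of_forall_pos (hξpos : ∀ ω, 0 < ξ ω) (hξint : Integrable ξ μ) :
    0 < ∫ ω, ξ ω ∂μ := by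
  rw [integral_pos_iff_support_of_nonneg (fun ω => (hξpos ω).le) hξint]
  have : Function.support ξ = univ := by
    ext ω
    simp [(hξpos ω).ne']
  simp [this]

lemma wDist_one (hξm : Measurable ξ) (hξpos : ∀ ω, 0 < ξ ω) (hξint : Integrable ξ μ) :
    wDist μ ξ 1 = 1 := by
  rw [wDist, intervalIntegral.integral_comp_sub_left (qf μ ξ) 1, sub_self, sub_zero,
    intervalIntegral_qf hξm hξpos, div_self (integral_pos_of_forall_pos hξpos hξint).ne']

lemma continuousOn_wDist (hξm : Measurable ξ) (hξpos : ∀ ω, 0 < ξ ω) (hξint : Integrable ξ μ) :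
    ContinuousOn (wDist μ ξ) (Icc 0 1) := by
  have h := intervalIntegral.continuousOn_primitive_interval'
    (intervalIntegrable_qf_sub hξm hξpos hξint) left_mem_uIcc
  rw [uIcc_of_le zero_le_one] at h
  exact h.div_const _

lemma strictMonoOn_wDist (hξm : Measurable ξ) (hξpos : ∀ ω, 0 < ξ ω) (hξint : Integrable ξ μ) :
    StrictMonoOn (wDist μ ξ) (Icc 0 1) := by
  intro x hx y hy hxy
  have hint := intervalIntegrable_qf_sub hξm hξpos hξint
  have hsub : ∀ {a b : ℝ}, a ∈ Icc (0:ℝ) 1 → b ∈ Icc (0:ℝ) 1 →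
      IntervalIntegrable (fun z => qf μ ξ (1 - z)) volume a b := fun ha hb =>
    hint.mono_set (by rw [uIcc_of_le zero_le_one]; exact ordConnected_Icc.uIcc_subset ha hb)
  have hpos : 0 < ∫ z in x..y, qf μ ξ (1 - z) :=
    intervalIntegral.intervalIntegral_pos_of_pos_on (hsub hx hy)
      (fun z hz => qf_pos hξm hξpos ⟨by linarith [hz.2, hy.2], by linarith [hz.1, hx.1]⟩) hxy
  have hadd := intervalIntegral.integral_add_adjacent_intervals
    (hsub (left_mem_Icc.2 zero_le_one) hx) (hsub hx hy)
  exact div_lt_div_of_pos_right (by linarith) (integral_pos_of_forall_pos hξpos hξint)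

lemma bijOn_wDist (hξm : Measurable ξ) (hξpos : ∀ ω, 0 < ξ ω) (hξint : Integrable ξ μ) :
    BijOn (wDist μ ξ) (Icc 0 1) (Icc 0 1) := by
  have hmono := strictMonoOn_wDist hξm hξpos hξint
  refine ⟨fun s hs => ⟨?_, ?_⟩, hmono.injOn, ?_⟩
  · simpa [wDist_zero] using hmono.monotoneOn (left_mem_Icc.2 zero_le_one) hs hs.1
  · simpa [wDist_one hξm hξpos hξint] using
      hmono.monotoneOn hs (right_mem_Icc.2 zero_le_one) hs.2
  · have := intermediate_value_Icc zero_le_one (continuousOn_wDist hξm hξpos hξint)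
    rwa [wDist_zero, wDist_one hξm hξpos hξint] at this

lemma wInv_mem (hξm : Measurable ξ) (hξpos : ∀ ω, 0 < ξ ω) (hξint : Integrable ξ μ)
    {s : ℝ} (hs : s ∈ Icc (0:ℝ) 1) : wInv μ ξ s ∈ Icc (0:ℝ) 1 :=
  Function.invFunOn_mem ((bijOn_wDist hξm hξpos hξint).surjOn hs)

lemma wDist_wInv (hξm : Measurable ξ) (hξpos : ∀ ω, 0 < ξ ω) (hξint : Integrable ξ μ)
    {s : ℝ} (hs : s ∈ Icc (0:ℝ) 1) : wDist μ ξ (wInv μ ξ s) = s :=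
  Function.invFunOn_eq ((bijOn_wDist hξm hξpos hξint).surjOn hs)

lemma wDist_mem_Ico (hξm : Measurable ξ) (hξpos : ∀ ω, 0 < ξ ω) (hξint : Integrable ξ μ)
    {s : ℝ} (hs : s ∈ Ico (0:ℝ) 1) : wDist μ ξ s ∈ Ico (0:ℝ) 1 := by
  refine ⟨((bijOn_wDist hξm hξpos hξint).mapsTo (Ico_subset_Icc_self hs)).1, ?_⟩
  simpa [wDist_one hξm hξpos hξint] using strictMonoOn_wDist hξm hξpos hξint
    (Ico_subset_Icc_self hs) (right_mem_Icc.2 zero_le_one) hs.2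

lemma wDist_preimage_Ico (hξm : Measurable ξ) (hξpos : ∀ ω, 0 < ξ ω) (hξint : Integrable ξ μ)
    {s : ℝ} (hs : s ∈ Icc (0:ℝ) 1) :
    wDist μ ξ ⁻¹' Ico 0 s ∩ Ico 0 1 = Ico 0 (wInv μ ξ s) := by
  have hv := wInv_mem hξm hξpos hξint hs
  have hlt : ∀ u ∈ Icc (0:ℝ) 1, wDist μ ξ u < s ↔ u < wInv μ ξ s := fun u hu => by
    rw [← (strictMonoOn_wDist hξm hξpos hξint).lt_iff_lt hu hv, wDist_wInv hξm hξpos hξint hs]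
  ext u
  constructor
  · rintro ⟨hu, huI⟩
    exact ⟨huI.1, (hlt u (Ico_subset_Icc_self huI)).1 hu.2⟩
  · intro hu
    have huI : u ∈ Ico (0:ℝ) 1 := ⟨hu.1, hu.2.trans_le hv.2⟩
    exact ⟨⟨(wDist_mem_Ico hξm hξpos hξint huI).1, (hlt u (Ico_subset_Icc_self huI)).2 hu.2⟩, huI⟩

end QuantileIntegral

lemma memG_HstarFun {lam η : ℝ} {δ : ℝ → ℝ} (hc : 0 ≤ (1 + lam) / η)
    (hmono : MonotoneOn (rtDeriv δ) (Ico 0 1))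
    (hrc : ∀ s ∈ Ico (0:ℝ) 1, ContinuousWithinAt (rtDeriv δ) (Ici s) s) :
    memG (HstarFun lam η δ) := by
  have hlt : ∀ s, s ≠ 1 → HstarFun lam η δ s = ENNReal.ofReal ((1 + lam) / η * rtDeriv δ s) :=
    fun s hs => if_neg hs
  have hone : HstarFun lam η δ 1
      = ⨆ t : Ico (0:ℝ) 1, ENNReal.ofReal ((1 + lam) / η * rtDeriv δ (t : ℝ)) := if_pos rfl
  have hm : MonotoneOn (HstarFun lam η δ) (Icc 0 1) := by
    intro x hx y hy hxy
    rcases hxy.eq_or_lt with rfl | hxy'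
    · rfl
    have hx1 : x < 1 := hxy'.trans_le hy.2
    rw [hlt x hx1.ne]
    rcases hy.2.lt_or_eq with hy1 | rfl
    · rw [hlt y hy1.ne]
      exact ENNReal.ofReal_le_ofReal
        (mul_le_mul_of_nonneg_left (hmono ⟨hx.1, hx1⟩ ⟨hy.1, hy1⟩ hxy) hc)
    · rw [hone]
      exact le_iSup (fun t : Ico (0:ℝ) 1 => ENNReal.ofReal ((1 + lam) / η * rtDeriv δ (t : ℝ)))
        ⟨x, hx.1, hx1⟩
  refine ⟨hm, fun s hs => ?_, fun s hs => ?_, ?_⟩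
  · rw [hlt s hs.2.ne]
    exact ENNReal.ofReal_ne_top
  · have h1 : ContinuousWithinAt (fun s => ENNReal.ofReal ((1 + lam) / η * rtDeriv δ s))
        (Ici s) s :=
      ENNReal.continuous_ofReal.continuousAt.comp_continuousWithinAt ((hrc s hs).const_mul _)
    refine h1.congr_of_eventuallyEq ?_ (hlt s hs.2.ne)
    filter_upwards [mem_nhdsWithin_of_mem_nhds (Iio_mem_nhds hs.2)] with t ht using hlt t ht.ne
  · have h0 : Ioi (0:ℝ) ∈ nhdsWithin 1 (Iic 1) := mem_nhdsWithin_of_mem_nhds (Ioi_mem_nhds one_pos)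
    refine tendsto_order.2 ⟨fun a ha => ?_, fun a ha => ?_⟩
    · rw [hone] at ha
      obtain ⟨⟨t, ht⟩, hat⟩ := lt_iSup_iff.1 ha
      rw [← hlt t ht.2.ne] at hat
      filter_upwards [mem_nhdsWithin_of_mem_nhds (Ioi_mem_nhds ht.2), self_mem_nhdsWithin]
        with u hu hu1
      exact hat.trans_le (hm (Ico_subset_Icc_self ht) ⟨ht.1.trans (le_of_lt hu), hu1⟩ (le_of_lt hu))
    · filter_upwards [h0, self_mem_nhdsWithin] with u hu hu1
      exact (hm ⟨le_of_lt hu, hu1⟩ (right_mem_Icc.2 zero_le_one) hu1).trans_lt ha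

section LogIntegrals

lemma measurable_erealPos : Measurable erealPos :=
  Measurable.ite (measurableSet_singleton _) measurable_const
    measurable_ereal_toReal.ennreal_ofReal

lemma erealPos_coe (a : ℝ) : erealPos (a : EReal) = ENNReal.ofReal a := by
  simp [erealPos]

lemma erealPos_log_add_le {h k : ℝ≥0∞} (hh : h ≠ ⊤) (hk0 : k ≠ 0) (hk : k ≠ ⊤) :
    erealPos (ENNReal.log h) + erealPos (-ENNReal.log k) + 1
      ≤ erealPos (ENNReal.log k) + erealPos (-ENNReal.log h) + h / k := by
  rcases eq_or_ne h 0 with rfl | hh0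
  · simp [erealPos]
  have hx := ENNReal.toReal_pos hh0 hh
  have hy := ENNReal.toReal_pos hk0 hk
  rw [ENNReal.log_pos_real hh0 hh, ENNReal.log_pos_real hk0 hk, ← EReal.coe_neg, ← EReal.coe_neg,
    erealPos_coe, erealPos_coe, erealPos_coe, erealPos_coe, ← ENNReal.ofReal_toReal hh,
    ← ENNReal.ofReal_toReal hk, ← ENNReal.ofReal_div_of_pos hy, ← ENNReal.ofReal_one,
    ENNReal.toReal_ofReal hx.le, ENNReal.toReal_ofReal hy.le]
  generalize h.toReal = x at *
  generalize k.toReal = y at *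
  have hlog := Real.log_le_sub_one_of_pos (div_pos hx hy)
  rw [Real.log_div hx.ne' hy.ne'] at hlog
  have hq := div_pos hx hy
  simp only [ENNReal.ofReal, ← ENNReal.coe_add, ENNReal.coe_le_coe, ← NNReal.coe_le_coe,
    NNReal.coe_add, Real.coe_toNNReal', max_eq_left hq.le, max_eq_left zero_le_one]
  have e1 := max_zero_sub_max_neg_zero_eq_self (Real.log x)
  have e2 := max_zero_sub_max_neg_zero_eq_self (Real.log y)
  linarith

lemma erealPos_neg_log_le {h k : ℝ≥0∞} (hh : h ≠ ⊤) (hk0 : k ≠ 0) (hk : k ≠ ⊤) :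
    erealPos (-ENNReal.log k) ≤ erealPos (-ENNReal.log h) + h / k := by
  rcases eq_or_ne h 0 with rfl | hh0
  · simp [erealPos]
  have hx := ENNReal.toReal_pos hh0 hh
  have hy := ENNReal.toReal_pos hk0 hk
  rw [ENNReal.log_pos_real hh0 hh, ENNReal.log_pos_real hk0 hk, ← EReal.coe_neg, ← EReal.coe_neg,
    erealPos_coe, erealPos_coe, ← ENNReal.ofReal_toReal hh,
    ← ENNReal.ofReal_toReal hk, ← ENNReal.ofReal_div_of_pos hy,
    ENNReal.toReal_ofReal hx.le, ENNReal.toReal_ofReal hy.le]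
  generalize h.toReal = x at *
  generalize k.toReal = y at *
  have hlog := Real.log_le_sub_one_of_pos (div_pos hx hy)
  rw [Real.log_div hx.ne' hy.ne'] at hlog
  refine le_trans (ENNReal.ofReal_le_ofReal ?_) ENNReal.ofReal_add_le
  linarith

lemma lintegral_erealPos_log_le {ν : Measure ℝ} (hν : ν univ = 1) {h k : ℝ → ℝ≥0∞}
    (hhm : AEMeasurable h ν) (hkm : AEMeasurable k ν) (hh : ∀ᵐ u ∂ν, h u ≠ ⊤)
    (hk0 : ∀ᵐ u ∂ν, k u ≠ 0) (hk : ∀ᵐ u ∂ν, k u ≠ ⊤) :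
    ∫⁻ u, erealPos (ENNReal.log (h u)) ∂ν + ∫⁻ u, erealPos (-ENNReal.log (k u)) ∂ν + 1
        ≤ ∫⁻ u, erealPos (ENNReal.log (k u)) ∂ν + ∫⁻ u, erealPos (-ENNReal.log (h u)) ∂ν
          + ∫⁻ u, h u / k u ∂ν ∧
      ∫⁻ u, erealPos (-ENNReal.log (k u)) ∂ν
        ≤ ∫⁻ u, erealPos (-ENNReal.log (h u)) ∂ν + ∫⁻ u, h u / k u ∂ν := by
  have hpos {f : ℝ → ℝ≥0∞} (hf : AEMeasurable f ν) :
      AEMeasurable (fun u => erealPos (ENNReal.log (f u))) ν :=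
    (measurable_erealPos.comp ENNReal.measurable_log).comp_aemeasurable hf
  have hneg {f : ℝ → ℝ≥0∞} (hf : AEMeasurable f ν) :
      AEMeasurable (fun u => erealPos (-ENNReal.log (f u))) ν :=
    (measurable_erealPos.comp (measurable_neg.comp ENNReal.measurable_log)).comp_aemeasurable hf
  have hd : AEMeasurable (fun u => h u / k u) ν := hhm.div hkm
  constructor
  · have h1 : (1 : ℝ≥0∞) = ∫⁻ _, 1 ∂ν := by rw [lintegral_one, hν]
    rw [h1, ← lintegral_add_left' (hpos hhm), ← lintegral_add_right _ measurable_const,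
      ← lintegral_add_left' (hpos hkm), ← lintegral_add_right' _ hd]
    refine lintegral_mono_ae ?_
    filter_upwards [hh, hk0, hk] with u h1 h2 h3 using erealPos_log_add_le h1 h2 h3
  · rw [← lintegral_add_left' (hneg hhm)]
    refine lintegral_mono_ae ?_
    filter_upwards [hh, hk0, hk] with u h1 h2 h3 using erealPos_neg_log_le h1 h2 h3

/-- Summation of the two logarithmic comparisons, when all of the integrals involved may be
infinite. -/
lemma ereal_weighted_sub_le {l e : ℝ≥0} (he : e ≠ 0)
    {P N Q P' N' R M S R' M' C C' : ℝ≥0∞}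
    (hv : l ≠ 0 → P + N' + 1 ≤ P' + N + Q ∧ N' ≤ N + Q)
    (hφ : R + M' + 1 ≤ R' + M + S ∧ M' ≤ M + S)
    (hQ : l * Q + S ≤ e * C) (hC' : e * C' = 1 + l) :
    ((l : ℝ) : EReal) * ((P : EReal) - N) + ((R : EReal) - M) - ((e : ℝ) : EReal) * C
      ≤ ((l : ℝ) : EReal) * ((P' : EReal) - N') + ((R' : EReal) - M')
        - ((e : ℝ) : EReal) * C' := by
  have he0 : (0:ℝ) < e := by positivity
  have he0' : (0:EReal) < ((e : ℝ) : EReal) := by exact_mod_cast he0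
  have hCt' : C' ≠ ⊤ := by
    rintro rfl
    rw [ENNReal.mul_top (by exact_mod_cast he)] at hC'
    exact ENNReal.coe_ne_top (r := 1 + l) (by rw [hC']; simp)
  by_cases hCt : C = ⊤
  · simp [hCt, EReal.coe_mul_top_of_pos he0]
  by_cases hMt : M = ⊤
  · simp [hMt]
  have hfin : e * C ≠ ⊤ := ENNReal.mul_ne_top ENNReal.coe_ne_top hCt
  have hSt : S ≠ ⊤ := ne_top_of_le_ne_top hfin (le_add_self.trans hQ)
  have hMt' : M' ≠ ⊤ := ne_top_of_le_ne_top (ENNReal.add_ne_top.2 ⟨hMt, hSt⟩) hφ.2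
  lift C to ℝ≥0 using hCt
  lift C' to ℝ≥0 using hCt'
  lift M to ℝ≥0 using hMt
  lift M' to ℝ≥0 using hMt'
  lift S to ℝ≥0 using hSt
  have hC'r : (e : ℝ) * C' = 1 + l := by exact_mod_cast hC'
  rcases eq_or_ne l 0 with rfl | hl
  · by_cases hRt' : R' = ⊤
    · subst hRt'
      simp only [NNReal.coe_zero, EReal.coe_zero, zero_mul, zero_add, EReal.coe_ennreal_top,
        EReal.coe_nnreal_eq_coe_real, EReal.top_sub_coe, ← EReal.coe_mul, le_top]
    · lift R' to ℝ≥0 using hRt'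
      have hRt : R ≠ ⊤ := ne_top_of_le_ne_top (b := (R' + M + S : ℝ≥0∞)) (by finiteness)
        (le_trans (by rw [add_assoc]; exact le_self_add) hφ.1)
      lift R to ℝ≥0 using hRt
      have h1 : (R : ℝ) + M' + 1 ≤ R' + M + S := by exact_mod_cast hφ.1
      have h2 : (S : ℝ) ≤ e * C := by
        have : (S : ℝ≥0∞) ≤ e * C := by simpa using hQ
        exact_mod_cast this
      simp only [NNReal.coe_zero, EReal.coe_zero, zero_mul, zero_add,
        EReal.coe_nnreal_eq_coe_real, ← EReal.coe_mul, ← EReal.coe_sub, EReal.coe_le_coe_iff]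
      simp only [NNReal.coe_zero] at hC'r
      linarith
  have hl0 : (0:ℝ) < l := by positivity
  obtain ⟨hv1, hv2⟩ := hv hl
  by_cases hNt : N = ⊤
  · simp [hNt, EReal.coe_mul_bot_of_pos hl0]
  have hQt : Q ≠ ⊤ := by
    rintro rfl
    rw [ENNReal.mul_top (by exact_mod_cast hl), top_add] at hQ
    exact hfin (top_le_iff.1 hQ)
  have hNt' : N' ≠ ⊤ := ne_top_of_le_ne_top (ENNReal.add_ne_top.2 ⟨hNt, hQt⟩) hv2
  lift N to ℝ≥0 using hNt
  lift N' to ℝ≥0 using hNt'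
  lift Q to ℝ≥0 using hQt
  by_cases hPt' : P' = ⊤
  · subst hPt'
    have : ((R' : EReal) - ((M' : ℝ≥0∞) : EReal)) ≠ ⊥ := by
      rw [EReal.coe_nnreal_eq_coe_real, sub_eq_add_neg, ← EReal.coe_neg]
      simp [EReal.add_eq_bot_iff]
    simp only [EReal.coe_ennreal_top, EReal.coe_nnreal_eq_coe_real, EReal.top_sub_coe,
      EReal.coe_mul_top_of_pos hl0, ← EReal.coe_mul] at this ⊢
    rw [EReal.top_add_of_ne_bot this, EReal.top_sub_coe]
    exact le_top
  lift P' to ℝ≥0 using hPt'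
  by_cases hRt' : R' = ⊤
  · subst hRt'
    simp only [EReal.coe_ennreal_top, EReal.coe_nnreal_eq_coe_real, EReal.top_sub_coe,
      ← EReal.coe_mul, ← EReal.coe_sub]
    rw [EReal.add_top_of_ne_bot (EReal.coe_ne_bot _), EReal.top_sub_coe]
    exact le_top
  lift R' to ℝ≥0 using hRt'
  have hRt : R ≠ ⊤ := ne_top_of_le_ne_top (b := (R' + M + S : ℝ≥0∞)) (by finiteness)
    (le_trans (by rw [add_assoc]; exact le_self_add) hφ.1)
  have hPt : P ≠ ⊤ := ne_top_of_le_ne_top (b := (P' + N + Q : ℝ≥0∞)) (by finiteness)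
    (le_trans (by rw [add_assoc]; exact le_self_add) hv1)
  lift R to ℝ≥0 using hRt
  lift P to ℝ≥0 using hPt
  have h1 : (R : ℝ) + M' + 1 ≤ R' + M + S := by exact_mod_cast hφ.1
  have h2 : (P : ℝ) + N' + 1 ≤ P' + N + Q := by exact_mod_cast hv1
  have h3 : (l : ℝ) * Q + S ≤ e * C := by exact_mod_cast hQ
  have h4 := mul_le_mul_of_nonneg_left h2 hl0.le
  simp only [EReal.coe_nnreal_eq_coe_real, ← EReal.coe_mul, ← EReal.coe_sub, ← EReal.coe_add,
    EReal.coe_le_coe_iff]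
  linarith

end LogIntegrals

section WeightedMeasure

variable {Ω : Type*} [MeasurableSpace Ω] {μ : Measure Ω} {ξ : Ω → ℝ} {Φ : Measure ℝ} {l : ℝ≥0}

/-- The measure on `[0,1)` whose distribution function is `φ(·;λ)`: the image under `w` of the
normalization of `λ` times Lebesgue measure plus `Φ`. -/
def weightedMap (μ : Measure Ω) (ξ : Ω → ℝ) (Φ : Measure ℝ) (l : ℝ≥0) : Measure ℝ :=
  (1 + l)⁻¹ • (l • volume.restrict (Ico (0:ℝ) 1) + Φ.restrict (Ico 0 1)).map (wDist μ ξ)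

instance [IsFiniteMeasure Φ] : IsFiniteMeasure (weightedMap μ ξ Φ l) := by
  unfold weightedMap
  infer_instance

variable [IsProbabilityMeasure μ]

lemma aemeasurable_wDist (hξm : Measurable ξ) (hξpos : ∀ ω, 0 < ξ ω) (hξint : Integrable ξ μ) :
    AEMeasurable (wDist μ ξ) (l • volume.restrict (Ico (0:ℝ) 1) + Φ.restrict (Ico 0 1)) := by
  have h (ν : Measure ℝ) : AEMeasurable (wDist μ ξ) (ν.restrict (Ico 0 1)) :=
    ((continuousOn_wDist hξm hξpos hξint).mono Ico_subset_Icc_self).aemeasurable measurableSet_Ico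
  exact ((h _).smul_measure _).add_measure (h _)

lemma weightedMap_apply (hξm : Measurable ξ) (hξpos : ∀ ω, 0 < ξ ω) (hξint : Integrable ξ μ)
    {s : Set ℝ} (hs : MeasurableSet s) :
    weightedMap μ ξ Φ l s = ((1 + l)⁻¹ : ℝ≥0) *
      (l * volume (wDist μ ξ ⁻¹' s ∩ Ico 0 1) + Φ (wDist μ ξ ⁻¹' s ∩ Ico 0 1)) := by
  rw [weightedMap, Measure.smul_apply,
    Measure.map_apply_of_aemeasurable (aemeasurable_wDist hξm hξpos hξint) hs]
  rw [Measure.add_apply, Measure.smul_apply, Measure.restrict_apply' measurableSet_Ico,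
    Measure.restrict_apply' measurableSet_Ico]
  rfl

lemma weightedMap_compl_Ico (hξm : Measurable ξ) (hξpos : ∀ ω, 0 < ξ ω) (hξint : Integrable ξ μ) :
    weightedMap μ ξ Φ l (Ico 0 1)ᶜ = 0 := by
  have : wDist μ ξ ⁻¹' (Ico 0 1)ᶜ ∩ Ico 0 1 = ∅ := by
    ext u
    simp only [mem_inter_iff, mem_preimage, mem_compl_iff, mem_empty_iff_false, iff_false, not_and]
    exact fun h hu => h (wDist_mem_Ico hξm hξpos hξint hu)
  rw [weightedMap_apply hξm hξpos hξint measurableSet_Ico.compl, this]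
  simp

lemma weightedMap_real_Ico (hξm : Measurable ξ) (hξpos : ∀ ω, 0 < ξ ω) (hξint : Integrable ξ μ)
    [IsFiniteMeasure Φ] {s : ℝ} (hs : s ∈ Icc (0:ℝ) 1) :
    (weightedMap μ ξ Φ l).real (Ico 0 s) = phiMinus μ ξ Φ l s := by
  have hv := wInv_mem hξm hξpos hξint hs
  rw [measureReal_def, weightedMap_apply hξm hξpos hξint measurableSet_Ico,
    wDist_preimage_Ico hξm hξpos hξint hs, Real.volume_Ico, sub_zero, phiMinus,
    ENNReal.toReal_mul, ENNReal.toReal_add (by finiteness) (by finiteness), ENNReal.toReal_mul,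
    ENNReal.toReal_ofReal hv.1]
  simp only [ENNReal.coe_toReal, NNReal.coe_add, NNReal.coe_inv, NNReal.coe_one]
  ring

lemma lintegral_weightedMap (hξm : Measurable ξ) (hξpos : ∀ ω, 0 < ξ ω) (hξint : Integrable ξ μ)
    {f : ℝ → ℝ≥0∞} (hf : AEMeasurable f (weightedMap μ ξ Φ l)) :
    l * (∫⁻ u in Ico 0 1, f (wDist μ ξ u)) + ∫⁻ u in Ico 0 1, f (wDist μ ξ u) ∂Φ
      = (1 + l) * ∫⁻ s in Ico 0 1, f s ∂weightedMap μ ξ Φ l := by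
  have hl : (1 + l : ℝ≥0) ≠ 0 := by positivity
  have hae : (Ico (0:ℝ) 1 : Set ℝ) =ᵐ[weightedMap μ ξ Φ l] univ :=
    Filter.eventuallyEq_univ.2 (mem_ae_iff.2 (weightedMap_compl_Ico hξm hξpos hξint))
  have hf' : AEMeasurable f
      ((l • volume.restrict (Ico (0:ℝ) 1) + Φ.restrict (Ico 0 1)).map (wDist μ ξ)) := by
    have := hf.smul_measure (1 + l)
    rwa [weightedMap, smul_smul, mul_inv_cancel₀ hl, one_smul] at this
  rw [setLIntegral_congr hae, Measure.restrict_univ, weightedMap, lintegral_smul_measure,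
    lintegral_map' hf' (aemeasurable_wDist hξm hξpos hξint), lintegral_add_measure,
    lintegral_smul_measure]
  simp only [ENNReal.smul_def, smul_eq_mul]
  rw [← mul_assoc, ← ENNReal.coe_one, ← ENNReal.coe_add, ← ENNReal.coe_mul, mul_inv_cancel₀ hl,
    ENNReal.coe_one, one_mul]

lemma ae_wDist_notMem_of_weightedMap_eq_zero (hξm : Measurable ξ) (hξpos : ∀ ω, 0 < ξ ω)
    (hξint : Integrable ξ μ) {s : Set ℝ} (hs : weightedMap μ ξ Φ l s = 0) :
    (l ≠ 0 → ∀ᵐ u ∂volume.restrict (Ico (0:ℝ) 1), wDist μ ξ u ∉ s) ∧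
      ∀ᵐ u ∂Φ.restrict (Ico 0 1), wDist μ ξ u ∉ s := by
  have h0 : (l • volume.restrict (Ico (0:ℝ) 1) + Φ.restrict (Ico 0 1)).map (wDist μ ξ) s = 0 := by
    have hl : ((1 + l)⁻¹ : ℝ≥0) ≠ 0 := by positivity
    rw [weightedMap, Measure.smul_apply, ENNReal.smul_def, smul_eq_mul, mul_eq_zero] at hs
    exact hs.resolve_left (by exact_mod_cast hl)
  have h1 := Measure.preimage_null_of_map_null (aemeasurable_wDist hξm hξpos hξint) h0
  rw [Measure.add_apply, add_eq_zero, Measure.smul_apply, ENNReal.smul_def, smul_eq_mul,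
    mul_eq_zero] at h1
  simp only [ae_iff, not_not]
  exact ⟨fun hl => h1.1.resolve_left (by exact_mod_cast hl), h1.2⟩

lemma wInv_one (hξm : Measurable ξ) (hξpos : ∀ ω, 0 < ξ ω) (hξint : Integrable ξ μ) :
    wInv μ ξ 1 = 1 := by
  have h1 : (1:ℝ) ∈ Icc (0:ℝ) 1 := right_mem_Icc.2 zero_le_one
  refine (strictMonoOn_wDist hξm hξpos hξint).injOn (wInv_mem hξm hξpos hξint h1) h1 ?_
  rw [wDist_wInv hξm hξpos hξint h1, wDist_one hξm hξpos hξint]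

lemma isConvexEnvelopeOn_weightedMap (hξm : Measurable ξ) (hξpos : ∀ ω, 0 < ξ ω)
    (hξint : Integrable ξ μ) [IsFiniteMeasure Φ] {δ : ℝ → ℝ}
    (hδ : IsConvexEnvelopeOn (Icc 0 1) (phiMinus μ ξ Φ l) δ) :
    IsConvexEnvelopeOn (Icc 0 1) (fun t => (weightedMap μ ξ Φ l).real (Ico 0 t)) δ := by
  refine ⟨hδ.1, fun t ht => ?_, fun g hg hle => hδ.2.2 g hg fun t ht => ?_⟩
  · simpa only [weightedMap_real_Ico hξm hξpos hξint ht] using hδ.2.1 t ht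
  · simpa only [weightedMap_real_Ico hξm hξpos hξint ht] using hle t ht

end WeightedMeasure

lemma measure_Ico_zero_one {Φ : Measure ℝ} [IsProbabilityMeasure Φ] (hsupp : Φ (Icc (0:ℝ) 1)ᶜ = 0)
    (hone : Φ {(1:ℝ)} = 0) : Φ (Ico 0 1) = 1 := by
  rw [← prob_compl_eq_zero_iff measurableSet_Ico]
  refine measure_mono_null (fun u hu => ?_) (measure_union_null hsupp hone)
  by_contra! hcon
  simp only [mem_union, mem_compl_iff, mem_singleton_iff, not_or, not_not] at hcon
  exact hu ⟨hcon.1.1, hcon.1.2.lt_of_ne hcon.2⟩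

section Maximizer

variable {lam η : ℝ} {δ : ℝ → ℝ}

lemma HstarFun_eq_mul {s : ℝ} (hc : 0 ≤ (1 + lam) / η) (hs : s ∈ Ico (0:ℝ) 1) :
    HstarFun lam η δ s
      = ENNReal.ofReal ((1 + lam) / η) * ENNReal.ofReal (rtDeriv δ s) := by
  rw [HstarFun, if_neg hs.2.ne, ENNReal.ofReal_mul hc]

lemma HstarFun_eq_zero_iff {s : ℝ} (hc : 0 < (1 + lam) / η) (hs : s ∈ Ico (0:ℝ) 1) :
    HstarFun lam η δ s = 0 ↔ rtDeriv δ s ≤ 0 := by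
  rw [HstarFun_eq_mul hc.le hs, mul_eq_zero, ENNReal.ofReal_eq_zero, ENNReal.ofReal_eq_zero]
  exact or_iff_right hc.not_ge

lemma lintegral_HstarFun {M : Measure ℝ} [IsFiniteMeasure M]
    (h : IsConvexEnvelopeOn (Icc 0 1) (fun t => M.real (Ico 0 t)) δ) (hc : 0 ≤ (1 + lam) / η) :
    ∫⁻ s in Ico 0 1, HstarFun lam η δ s
      = ENNReal.ofReal ((1 + lam) / η) * ENNReal.ofReal (M.real (Ico 0 1)) := by
  rw [setLIntegral_congr_fun measurableSet_Ico fun s hs => HstarFun_eq_mul hc hs,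
    lintegral_const_mul' _ _ ENNReal.ofReal_ne_top, ← setLIntegral_congr Ioo_ae_eq_Ico,
    h.1.setLIntegral_rtDeriv h.monotoneOn h.continuousOn le_rfl zero_le_one le_rfl,
    h.apply_one, h.apply_zero, sub_zero]

lemma mul_lintegral_div_HstarFun_le {M : Measure ℝ} [IsFiniteMeasure M] {H : ℝ → ℝ≥0∞}
    (h : IsConvexEnvelopeOn (Icc 0 1) (fun t => M.real (Ico 0 t)) δ) (hc : 0 < (1 + lam) / η)
    (hH : MonotoneOn H (Ico 0 1)) (hfin : ∀ s ∈ Ico (0:ℝ) 1, H s ≠ ⊤) :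
    ENNReal.ofReal ((1 + lam) / η) * ∫⁻ s in Ico 0 1, H s / HstarFun lam η δ s ∂M
      ≤ ∫⁻ s in Ico 0 1, H s := by
  refine le_trans (le_of_eq ?_) (h.lintegral_div_rtDeriv_le hH hfin)
  have h0 : ENNReal.ofReal ((1 + lam) / η) ≠ 0 := by simpa using hc
  rw [← lintegral_const_mul' _ _ ENNReal.ofReal_ne_top]
  refine setLIntegral_congr_fun measurableSet_Ico fun s hs => ?_
  rw [HstarFun_eq_mul hc.le hs, div_eq_mul_inv (H s), ENNReal.mul_inv (Or.inl h0) (Or.inl ENNReal.ofReal_ne_top), mul_left_comm,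
    ← mul_assoc (ENNReal.ofReal _), ENNReal.mul_inv_cancel h0 ENNReal.ofReal_ne_top, one_mul,
    div_eq_mul_inv]

end Maximizer

/-- `H* = ((1+λ)/η) δ'₊(·;λ)` lies in `𝔾` and maximizes the Lagrangian
`L(·; λ, η)` over `𝔾`, where `δ(·;λ)` is the convex envelope of `φ(·−;λ)` on `[0,1]`. -/
theorem lagrangian_maximizer
    {Ω : Type*} [MeasurableSpace Ω] (μ : Measure Ω) [IsProbabilityMeasure μ]
    (ξ : Ω → ℝ) (hξm : Measurable ξ) (hξpos : ∀ ω, 0 < ξ ω) (hξint : Integrable ξ μ)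
    (T r θ : ℝ) (hT : 0 < T) (hr : 0 < r) (hθ : 0 < θ)
    (hlog : μ.map (fun ω => Real.log (ξ ω))
      = gaussianReal (-(r + θ ^ 2 / 2) * T) ((θ ^ 2 * T).toNNReal))
    (Φ : Measure ℝ) [IsProbabilityMeasure Φ]
    (hΦsupp : Φ (Set.Icc (0:ℝ) 1)ᶜ = 0) (hΦone : Φ {(1:ℝ)} = 0)
    (hΦnotunif : Φ ≠ volume.restrict (Set.Icc (0:ℝ) 1))
    (lam η : ℝ) (hlam : 0 ≤ lam) (hη : 0 < η)
    (δ : ℝ → ℝ) (hδ : IsConvexEnvelopeOn (Set.Icc 0 1) (phiMinus μ ξ Φ lam) δ) :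
    memG (HstarFun lam η δ) ∧
      ∀ H : ℝ → ℝ≥0∞, memG H →
        Lfun μ ξ Φ lam η H ≤ Lfun μ ξ Φ lam η (HstarFun lam η δ) := by
  have hwm : MonotoneOn (wDist μ ξ) (Icc 0 1) := (strictMonoOn_wDist hξm hξpos hξint).monotoneOn
  have hwI : ∀ u ∈ Ico (0:ℝ) 1, wDist μ ξ u ∈ Ico (0:ℝ) 1 :=
    fun u hu => wDist_mem_Ico hξm hξpos hξint hu
  have hc : 0 < (1 + lam) / η := by positivity
  lift lam to ℝ≥0 using hlam
  lift η to ℝ≥0 using hη.le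
  have hη0 : η ≠ 0 := by
    rintro rfl
    exact lt_irrefl _ hη
  have henv := isConvexEnvelopeOn_weightedMap hξm hξpos hξint hδ
  have hΦI := measure_Ico_zero_one hΦsupp hΦone
  have hone : (weightedMap μ ξ Φ lam).real (Ico 0 1) = 1 := by
    rw [weightedMap_real_Ico hξm hξpos hξint (right_mem_Icc.2 zero_le_one), phiMinus,
      wInv_one hξm hξpos hξint, hΦI, mul_one, ENNReal.toReal_one]
    exact div_self (by positivity)
  have hG : memG (HstarFun lam η δ) :=
    memG_HstarFun hc.le (henv.1.monotoneOn_rtDeriv henv.monotoneOn)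
      fun s hs => henv.1.continuousWithinAt_rtDeriv henv.monotoneOn hs
  refine ⟨hG, fun H hH => ?_⟩
  obtain ⟨hnv, hnΦ⟩ := ae_wDist_notMem_of_weightedMap_eq_zero hξm hξpos hξint
    henv.measure_rtDeriv_nonpos
  have hne : ∀ u ∈ Ico (0:ℝ) 1, wDist μ ξ u ∉ {s ∈ Ico (0:ℝ) 1 | rtDeriv δ s ≤ 0} →
      HstarFun lam η δ (wDist μ ξ u) ≠ 0 := fun u hu hn h0 =>
    hn ⟨hwI u hu, (HstarFun_eq_zero_iff hc (hwI u hu)).1 h0⟩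
  have hk0Φ : ∀ᵐ u ∂Φ.restrict (Ico 0 1), HstarFun lam η δ (wDist μ ξ u) ≠ 0 := by
    filter_upwards [hnΦ, ae_restrict_mem measurableSet_Ico] with u h1 h2 using hne u h2 h1
  have hk0v : lam ≠ 0 →
      ∀ᵐ u ∂volume.restrict (Ico (0:ℝ) 1), HstarFun lam η δ (wDist μ ξ u) ≠ 0 := fun hl => by
    filter_upwards [hnv hl, ae_restrict_mem measurableSet_Ico] with u h1 h2 using hne u h2 h1
  have hstar : ¬ ∃ s ∈ Icc (0:ℝ) 1,
      HstarFun lam η δ (wDist μ ξ s) = 0 ∧ 0 < Φ (Icc 0 s) := by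
    rintro ⟨s, hs, h0, hpos⟩
    rw [ae_iff, Measure.restrict_apply' measurableSet_Ico] at hk0Φ
    refine hpos.ne' (measure_mono_null (fun u hu => ?_) (measure_union_null hk0Φ hΦone))
    have huI : u ∈ Icc (0:ℝ) 1 := ⟨hu.1, hu.2.trans hs.2⟩
    rcases huI.2.lt_or_eq with hlt | heq
    · refine Or.inl ⟨not_not.2 (le_antisymm ?_ bot_le), hu.1, hlt⟩
      rw [← h0]
      have hmaps := (bijOn_wDist hξm hξpos hξint).mapsTo
      exact hG.1 (hmaps huI) (hmaps hs) (hwm huI hs hu.2)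
    · exact Or.inr heq
  have hmeas {f : ℝ → ℝ≥0∞} (hf : memG f) (ν : Measure ℝ) :
      AEMeasurable (fun u => f (wDist μ ξ u)) (ν.restrict (Ico 0 1)) :=
    aemeasurable_restrict_of_monotoneOn measurableSet_Ico fun x hx y hy hxy =>
      hf.1 (Ico_subset_Icc_self (hwI x hx)) (Ico_subset_Icc_self (hwI y hy))
        (hwm (Ico_subset_Icc_self hx) (Ico_subset_Icc_self hy) hxy)
  have hfin {f : ℝ → ℝ≥0∞} (hf : memG f) (ν : Measure ℝ) :
      ∀ᵐ u ∂ν.restrict (Ico 0 1), f (wDist μ ξ u) ≠ ⊤ := by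
    filter_upwards [ae_restrict_mem measurableSet_Ico] with u hu using hf.2.1 _ (hwI u hu)
  have hcm : (η : ℝ≥0∞) * ENNReal.ofReal ((1 + lam) / η) = 1 + lam := by
    rw [← ENNReal.ofReal_coe_nnreal, ← ENNReal.ofReal_mul hη.le, mul_div_cancel₀ _ hη.ne',
      ENNReal.ofReal_add zero_le_one lam.coe_nonneg, ENNReal.ofReal_one, ENNReal.ofReal_coe_nnreal]
  have hcost : (η : ℝ≥0∞) * ∫⁻ s in Ico (0:ℝ) 1, HstarFun lam η δ s = 1 + lam := by
    rw [lintegral_HstarFun henv hc.le, hone, ENNReal.ofReal_one, mul_one, hcm]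
  have hae {f : ℝ → ℝ≥0∞} (hf : memG f) : AEMeasurable f (weightedMap μ ξ Φ lam) := by
    have hI : (weightedMap μ ξ Φ lam).restrict (Ico 0 1) = weightedMap μ ξ Φ lam :=
      Measure.restrict_eq_self_of_ae_mem
        (mem_ae_iff.2 (weightedMap_compl_Ico hξm hξpos hξint))
    rw [← hI]
    exact aemeasurable_restrict_of_monotoneOn measurableSet_Ico (hf.1.mono Ico_subset_Icc_self)
  have hbudget : lam * (∫⁻ u in Ico 0 1, H (wDist μ ξ u) / HstarFun lam η δ (wDist μ ξ u))
        + ∫⁻ u in Ico 0 1, H (wDist μ ξ u) / HstarFun lam η δ (wDist μ ξ u) ∂Φ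
      ≤ η * ∫⁻ s in Ico 0 1, H s := by
    rw [lintegral_weightedMap hξm hξpos hξint (f := fun s => H s / HstarFun lam η δ s)
      ((hae hH).div (hae hG)), ← hcm, mul_assoc]
    exact mul_le_mul_right (mul_lintegral_div_HstarFun_le henv hc
      (hH.1.mono Ico_subset_Icc_self) hH.2.1) _
  simp only [Lfun, if_neg hstar]
  split_ifs with hcond
  · simp
  · exact ereal_weighted_sub_le hη0
      (fun hl => lintegral_erealPos_log_le (by simp) (hmeas hH _) (hmeas hG _) (hfin hH _)
        (hk0v hl) (hfin hG _))
      (lintegral_erealPos_log_le (by rw [Measure.restrict_apply_univ, hΦI]) (hmeas hH _)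
        (hmeas hG _) (hfin hH _) hk0Φ (hfin hG _))
      hbudget hcost

end
end

section
/- Let α ∈ (0,1) and λ > 0, let c = w(α), and define φ(s) = ((1/α) + λ) w⁻¹(s)/(1+λ) for 0 ≤ s ≤ c and φ(s) = (1 + λ w⁻¹(s))/(1+λ) for c < s ≤ 1 (a continuous function on [0,1]). Then there exists a unique pair (t₁, t₂) with 0 < t₁ < c < t₂ < 1 such that φ'(t₁) = φ'(t₂) and φ'(t₁) = (φ(t₂) − φ(t₁))/(t₂ − t₁); moreover, the convex envelope of φ on [0,1] equals φ on [0, t₁] and on (t₂, 1], and equals the common tangent line s ↦ φ(t₁) + φ'(t₁)(s − t₁) on (t₁, t₂]. -/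
open MeasureTheory ProbabilityTheory Set
open scoped ENNReal NNReal Classical

noncomputable section

/-- The Expected-Shortfall distorted function
`φ(s) = ((1/α)+λ) w⁻¹(s)/(1+λ)` for `s ≤ w(α)`, `φ(s) = (1 + λ w⁻¹(s))/(1+λ)` else. -/
def phiES {Ω : Type*} [MeasurableSpace Ω] (μ : Measure Ω) (ξ : Ω → ℝ)
    (α lam : ℝ) (s : ℝ) : ℝ :=
  if s ≤ wDist μ ξ α then (1 / α + lam) * wInv μ ξ s / (1 + lam)
  else (1 + lam * wInv μ ξ s) / (1 + lam)

/-- `v` is strictly convex on `[0,1]` with derivative `d` on `(0,1)`, where `d` maps `(0,1)` onto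
`(0,∞)` with continuous inverse `e`. -/
structure IsSlopeModel (v d e : ℝ → ℝ) : Prop where
  hasDerivAt : ∀ t ∈ Ioo (0:ℝ) 1, HasDerivAt v (d t) t
  tangent_lt : ∀ t ∈ Ioo (0:ℝ) 1, ∀ s ∈ Icc (0:ℝ) 1, s ≠ t → v t + d t * (s - t) < v s
  d_pos : ∀ t ∈ Ioo (0:ℝ) 1, 0 < d t
  e_mem : ∀ m, 0 < m → e m ∈ Ioo (0:ℝ) 1
  d_e : ∀ m, 0 < m → d (e m) = m
  continuousOn_e : ContinuousOn e (Ioi 0)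

namespace IsSlopeModel

variable {v d e : ℝ → ℝ}

lemma tangent_le (h : IsSlopeModel v d e) {t s : ℝ} (ht : t ∈ Ioo (0:ℝ) 1) (hs : s ∈ Icc (0:ℝ) 1) :
    v t + d t * (s - t) ≤ v s := by
  rcases eq_or_ne s t with rfl | hst
  · simp
  · exact (h.tangent_lt t ht s hs hst).le

lemma strictMonoOn (h : IsSlopeModel v d e) : StrictMonoOn d (Ioo 0 1) := by
  intro x hx y hy hxy
  have h₁ := h.tangent_lt x hx y (Ioo_subset_Icc_self hy) hxy.ne'
  have h₂ := h.tangent_lt y hy x (Ioo_subset_Icc_self hx) hxy.ne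
  nlinarith

lemma exists_common_tangent (h : IsSlopeModel v d e) {a b k c : ℝ}
    (hb : 0 < b) (hba : b < a) (hc : c ∈ Ioo (0:ℝ) 1)
    (hk : a * v c = b * v c + k) :
    ∃ t₁ t₂, 0 < t₁ ∧ t₁ < c ∧ c < t₂ ∧ t₂ < 1 ∧ a * d t₁ = b * d t₂ ∧
      a * d t₁ * (t₂ - t₁) = b * v t₂ + k - a * v t₁ := by
  have ha : 0 < a := hb.trans hba
  have hdc := h.d_pos c hc
  have hinj := h.strictMonoOn.injOn
  have hcont : ∀ q : ℝ, 0 < q → ContinuousOn (fun m => e (m / q)) (Ioi 0) := fun q hq =>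
    h.continuousOn_e.comp (by fun_prop) fun m hm => div_pos hm hq
  have hvcont : ∀ q : ℝ, 0 < q → ContinuousOn (fun m => v (e (m / q))) (Ioi 0) := fun q hq =>
    ContinuousOn.comp (t := Ioo 0 1)
      (fun t ht => (h.hasDerivAt t ht).continuousAt.continuousWithinAt) (hcont q hq)
      fun m hm => h.e_mem _ (div_pos hm hq)
  have hsub : Icc (b * d c) (a * d c) ⊆ Ioi (0:ℝ) := fun m hm =>
    (by positivity : 0 < b * d c).trans_le hm.1
  have hle : b * d c ≤ a * d c := by nlinarith
  let H : ℝ → ℝ := fun m =>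
    b * v (e (m / b)) + k - a * v (e (m / a)) - m * (e (m / b) - e (m / a))
  have hH : ContinuousOn H (Icc (b * d c) (a * d c)) := by
    have h1 := (hcont a ha).mono hsub
    have h2 := (hcont b hb).mono hsub
    have h3 := (hvcont a ha).mono hsub
    have h4 := (hvcont b hb).mono hsub
    exact (((h4.const_mul b).add continuousOn_const).sub (h3.const_mul a)).sub
      (continuousOn_id.mul (h2.sub h1))
  have hec : e (d c) = c := hinj (h.e_mem _ hdc) hc (h.d_e _ hdc)
  have hHl : 0 < H (b * d c) := by
    have hpos : 0 < b * d c / a := by positivity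
    have hlt : e (b * d c / a) ≠ c := fun heq => by
      have := h.d_e _ hpos
      rw [heq, eq_div_iff ha.ne'] at this
      nlinarith
    have := h.tangent_lt _ (h.e_mem _ hpos) c (Ioo_subset_Icc_self hc) hlt.symm
    rw [h.d_e _ hpos] at this
    have h2 := mul_lt_mul_of_pos_left this ha
    have h3 : a * (b * d c / a * (c - e (b * d c / a))) = b * d c * (c - e (b * d c / a)) := by
      field_simp
    simp only [H, mul_div_cancel_left₀ _ hb.ne', hec]
    linarith
  have hHr : H (a * d c) < 0 := by
    have hpos : 0 < a * d c / b := by positivity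
    have hlt : e (a * d c / b) ≠ c := fun heq => by
      have := h.d_e _ hpos
      rw [heq, eq_div_iff hb.ne'] at this
      nlinarith
    have := h.tangent_lt _ (h.e_mem _ hpos) c (Ioo_subset_Icc_self hc) hlt.symm
    rw [h.d_e _ hpos] at this
    have h2 := mul_lt_mul_of_pos_left this hb
    have h3 : b * (a * d c / b * (c - e (a * d c / b))) = a * d c * (c - e (a * d c / b)) := by
      field_simp
    simp only [H, mul_div_cancel_left₀ _ ha.ne', hec]
    linarith
  obtain ⟨m, hm, hm0⟩ := intermediate_value_Ioo' hle hH (show (0:ℝ) ∈ Ioo _ _ from ⟨hHr, hHl⟩)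
  have hmpos : 0 < m := hsub (Ioo_subset_Icc_self hm)
  have hma := div_pos hmpos ha
  have hmb := div_pos hmpos hb
  have hda : a * d (e (m / a)) = m := by rw [h.d_e _ hma]; field_simp
  have hdb : b * d (e (m / b)) = m := by rw [h.d_e _ hmb]; field_simp
  refine ⟨e (m / a), e (m / b), (h.e_mem _ hma).1, ?_, ?_, (h.e_mem _ hmb).2, ?_, ?_⟩
  · rw [← h.strictMonoOn.lt_iff_lt (h.e_mem _ hma) hc, h.d_e _ hma, div_lt_iff₀ ha]
    linarith [hm.2]
  · rw [← h.strictMonoOn.lt_iff_lt hc (h.e_mem _ hmb), h.d_e _ hmb, lt_div_iff₀ hb]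
    linarith [hm.1]
  · rw [hda, hdb]
  · rw [hda]
    simp only [H] at hm0
    linarith

lemma not_lt_of_common_tangent (h : IsSlopeModel v d e) {a b k c s₁ s₂ t₁ t₂ : ℝ}
    (hb : 0 < b) (hba : b < a)
    (hs₁ : 0 < s₁) (hs₂c : c < s₂) (hs₂ : s₂ < 1)
    (ht₁c : t₁ < c) (ht₂c : c < t₂) (ht₂ : t₂ < 1)
    (hsl : a * d s₁ * (s₂ - s₁) = b * v s₂ + k - a * v s₁)
    (htd : a * d t₁ = b * d t₂) (htl : a * d t₁ * (t₂ - t₁) = b * v t₂ + k - a * v t₁) :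
    ¬ s₁ < t₁ := by
  intro hlt
  have ha : 0 < a := hb.trans hba
  have hmono := h.strictMonoOn (show s₁ ∈ Ioo (0:ℝ) 1 by constructor <;> linarith)
    (show t₁ ∈ Ioo (0:ℝ) 1 by constructor <;> linarith) hlt
  have h₁ := h.tangent_le (t := s₁) (s := t₁) (by constructor <;> linarith)
    (by constructor <;> linarith)
  have h₂ := h.tangent_le (t := t₂) (s := s₂) (by constructor <;> linarith)
    (by constructor <;> linarith)
  have h₁' := mul_le_mul_of_nonneg_left h₁ ha.le
  have h₂' := mul_le_mul_of_nonneg_left h₂ hb.le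
  have h₃ : b * (v t₂ + d t₂ * (s₂ - t₂)) = b * v t₂ + a * d t₁ * (s₂ - t₂) := by
    rw [htd]; ring
  have h₄ : 0 < a * (d t₁ - d s₁) * (s₂ - t₁) :=
    mul_pos (mul_pos ha (by linarith)) (by linarith)
  nlinarith

end IsSlopeModel

lemma convexOn_Icc_of_exists_support {f : ℝ → ℝ}
    (hf : ∀ z ∈ Ioo (0:ℝ) 1, ∃ m, ∀ s ∈ Icc (0:ℝ) 1, f z + m * (s - z) ≤ f s) :
    ConvexOn ℝ (Icc 0 1) f := by
  refine LinearOrder.convexOn_of_lt (convex_Icc 0 1) fun x hx y hy hxy p q hp hq hpq => ?_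
  simp only [smul_eq_mul]
  obtain rfl : q = 1 - p := by linarith
  obtain ⟨m, hm⟩ := hf (p * x + (1 - p) * y)
    ⟨by nlinarith [hx.1, hy.1], by nlinarith [hx.2, hy.2]⟩
  have h₁ := mul_le_mul_of_nonneg_left (hm x hx) hp.le
  have h₂ := mul_le_mul_of_nonneg_left (hm y hy) hq.le
  nlinarith

/-- The function equal to `a * v` up to `c` and to `b * v + k` beyond `c`. -/
def kinked (v : ℝ → ℝ) (a b k c s : ℝ) : ℝ := if s ≤ c then a * v s else b * v s + k

namespace IsSlopeModel

variable {v d e : ℝ → ℝ}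

lemma deriv_kinked_left (h : IsSlopeModel v d e) {a b k c t : ℝ}
    (hc : c < 1) (ht : 0 < t) (htc : t < c) :
    deriv (kinked v a b k c) t = a * d t := by
  have h₁ := (h.hasDerivAt t ⟨ht, htc.trans hc⟩).const_mul a
  refine (h₁.congr_of_eventuallyEq ?_).deriv
  filter_upwards [Iio_mem_nhds htc] with s hs
  rw [kinked, if_pos (le_of_lt hs)]

lemma deriv_kinked_right (h : IsSlopeModel v d e) {a b k c t : ℝ}
    (hc : 0 < c) (htc : c < t) (ht : t < 1) :
    deriv (kinked v a b k c) t = b * d t := by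
  have h₁ := ((h.hasDerivAt t ⟨hc.trans htc, ht⟩).const_mul b).add_const k
  refine (h₁.congr_of_eventuallyEq ?_).deriv
  filter_upwards [Ioi_mem_nhds htc] with s hs
  rw [kinked, if_neg (not_le_of_gt hs)]

lemma isConvexEnvelopeOn_kinked (h : IsSlopeModel v d e) {a b k c t₁ t₂ : ℝ}
    (hb : 0 < b) (hba : b < a)
    (ht₁ : 0 < t₁) (ht₁c : t₁ < c) (ht₂c : c < t₂) (ht₂ : t₂ < 1)
    (htd : a * d t₁ = b * d t₂) (htl : a * d t₁ * (t₂ - t₁) = b * v t₂ + k - a * v t₁) :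
    IsConvexEnvelopeOn (Icc 0 1) (kinked v a b k c)
      (fun s => if s ≤ t₁ then kinked v a b k c s
        else if s ≤ t₂ then kinked v a b k c t₁ + a * d t₁ * (s - t₁)
        else kinked v a b k c s) := by
  have ha : 0 < a := hb.trans hba
  have ht₁m : t₁ ∈ Ioo (0:ℝ) 1 := by constructor <;> linarith
  have ht₂m : t₂ ∈ Ioo (0:ℝ) 1 := by constructor <;> linarith
  have hleft : ∀ t ∈ Ioo (0:ℝ) 1, ∀ s ∈ Icc (0:ℝ) 1, a * v t + a * d t * (s - t) ≤ a * v s :=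
    fun t ht s hs => by
      have := mul_le_mul_of_nonneg_left (h.tangent_le ht hs) ha.le
      linarith
  have hright : ∀ t ∈ Ioo (0:ℝ) 1, ∀ s ∈ Icc (0:ℝ) 1, b * v t + b * d t * (s - t) ≤ b * v s :=
    fun t ht s hs => by
      have := mul_le_mul_of_nonneg_left (h.tangent_le ht hs) hb.le
      linarith
  have hline : ∀ s ∈ Icc (0:ℝ) 1, a * v t₁ + a * d t₁ * (s - t₁) ≤ b * v s + k := fun s hs => by
    have := hright t₂ ht₂m s hs
    rw [← htd] at this
    linarith
  have hδ : (fun s => if s ≤ t₁ then kinked v a b k c s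
        else if s ≤ t₂ then kinked v a b k c t₁ + a * d t₁ * (s - t₁)
        else kinked v a b k c s) = fun s => if s ≤ t₁ then a * v s
        else if s ≤ t₂ then a * v t₁ + a * d t₁ * (s - t₁) else b * v s + k := by
    funext s
    simp only [kinked]
    split_ifs <;> first | rfl | (exfalso; linarith)
  rw [hδ]
  refine ⟨convexOn_Icc_of_exists_support fun z hz => ?_, fun s hs => ?_, fun g hg hgle s hs => ?_⟩
  · rcases le_or_gt z t₁ with hz₁ | hz₁
    · refine ⟨a * d z, fun s hs => ?_⟩
      have hdz : a * d z ≤ a * d t₁ :=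
        mul_le_mul_of_nonneg_left (h.strictMonoOn.monotoneOn hz ht₁m hz₁) ha.le
      have hsz := hleft z hz s hs
      have htz := hleft z hz t₁ (Ioo_subset_Icc_self ht₁m)
      have hls := hline s hs
      simp only [if_pos hz₁]
      split_ifs <;> nlinarith
    · rcases le_or_gt z t₂ with hz₂ | hz₂
      · refine ⟨a * d t₁, fun s hs => ?_⟩
        have hsz := hleft t₁ ht₁m s hs
        have hls := hline s hs
        simp only [if_neg hz₁.not_ge, if_pos hz₂]
        split_ifs <;> linarith
      · refine ⟨b * d z, fun s hs => ?_⟩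
        have hdz : b * d t₂ ≤ b * d z :=
          mul_le_mul_of_nonneg_left (h.strictMonoOn.monotoneOn ht₂m hz hz₂.le) hb.le
        have hsz := hright z hz s hs
        have htz := hright z hz t₂ (Ioo_subset_Icc_self ht₂m)
        have hls := hleft t₁ ht₁m s hs
        rw [← htd] at hdz
        simp only [if_neg hz₁.not_ge, if_neg hz₂.not_ge]
        split_ifs <;> nlinarith
  · have hsz := hleft t₁ ht₁m s hs
    have hls := hline s hs
    simp only [kinked]
    split_ifs <;> linarith
  · have hgs := hgle s hs
    simp only [kinked] at hgs
    beta_reduce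
    split_ifs with hs₁ hs₂
    · rwa [if_pos (hs₁.trans ht₁c.le)] at hgs
    · have hg₁ := hgle t₁ (Ioo_subset_Icc_self ht₁m)
      have hg₂ := hgle t₂ (Ioo_subset_Icc_self ht₂m)
      rw [kinked, if_pos ht₁c.le] at hg₁
      rw [kinked, if_neg ht₂c.not_ge] at hg₂
      have hlen : 0 < t₂ - t₁ := by linarith
      have hconv := hg.2 (Ioo_subset_Icc_self ht₁m) (Ioo_subset_Icc_self ht₂m)
        (div_nonneg (by linarith : 0 ≤ t₂ - s) hlen.le)
        (div_nonneg (by linarith : 0 ≤ s - t₁) hlen.le)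
        (by field_simp; ring)
      have harg : ((t₂ - s) / (t₂ - t₁)) • t₁ + ((s - t₁) / (t₂ - t₁)) • t₂ = s := by
        simp only [smul_eq_mul]; field_simp; ring
      rw [harg] at hconv
      simp only [smul_eq_mul] at hconv
      have h₁ := mul_le_mul_of_nonneg_left hg₁
        (div_nonneg (by linarith : 0 ≤ t₂ - s) hlen.le)
      have h₂ := mul_le_mul_of_nonneg_left hg₂
        (div_nonneg (by linarith : 0 ≤ s - t₁) hlen.le)
      have hv₂ : b * v t₂ + k = a * v t₁ + a * d t₁ * (t₂ - t₁) := by linarith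
      rw [hv₂] at h₂
      calc g s ≤ _ := hconv
        _ ≤ _ := add_le_add h₁ h₂
        _ = _ := by field_simp; ring
    · rwa [if_neg (by linarith)] at hgs

theorem existsUnique_common_tangent_and_envelope (h : IsSlopeModel v d e) {a b k c : ℝ}
    (hb : 0 < b) (hba : b < a)
    (hc : c ∈ Ioo (0:ℝ) 1) (hk : a * v c = b * v c + k) :
    (∃! p : ℝ × ℝ,
      (0 < p.1 ∧ p.1 < c ∧ c < p.2 ∧ p.2 < 1) ∧
        deriv (kinked v a b k c) p.1 = deriv (kinked v a b k c) p.2 ∧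
        deriv (kinked v a b k c) p.1
          = (kinked v a b k c p.2 - kinked v a b k c p.1) / (p.2 - p.1)) ∧
    ∀ t₁ t₂ : ℝ, 0 < t₁ → t₁ < c → c < t₂ → t₂ < 1 →
      deriv (kinked v a b k c) t₁ = deriv (kinked v a b k c) t₂ →
      deriv (kinked v a b k c) t₁
        = (kinked v a b k c t₂ - kinked v a b k c t₁) / (t₂ - t₁) →
      IsConvexEnvelopeOn (Icc 0 1) (kinked v a b k c)
        (fun s => if s ≤ t₁ then kinked v a b k c s
          else if s ≤ t₂ then kinked v a b k c t₁ + deriv (kinked v a b k c) t₁ * (s - t₁)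
          else kinked v a b k c s) := by
  have key : ∀ t₁ t₂ : ℝ, 0 < t₁ → t₁ < c → c < t₂ → t₂ < 1 →
      ((deriv (kinked v a b k c) t₁ = deriv (kinked v a b k c) t₂ ∧
        deriv (kinked v a b k c) t₁
          = (kinked v a b k c t₂ - kinked v a b k c t₁) / (t₂ - t₁)) ↔
      (a * d t₁ = b * d t₂ ∧ a * d t₁ * (t₂ - t₁) = b * v t₂ + k - a * v t₁)) := by
    intro t₁ t₂ h₁ h₁c h₂c h₂
    rw [h.deriv_kinked_left hc.2 h₁ h₁c, h.deriv_kinked_right hc.1 h₂c h₂,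
      eq_div_iff (by linarith), kinked, kinked, if_pos h₁c.le, if_neg h₂c.not_ge]
  refine ⟨?_, fun t₁ t₂ h₁ h₁c h₂c h₂ hd hl => ?_⟩
  · obtain ⟨t₁, t₂, h₁, h₁c, h₂c, h₂, hd, hl⟩ := h.exists_common_tangent hb hba hc hk
    refine ⟨(t₁, t₂), ⟨⟨h₁, h₁c, h₂c, h₂⟩, (key t₁ t₂ h₁ h₁c h₂c h₂).2 ⟨hd, hl⟩⟩, ?_⟩
    rintro ⟨s₁, s₂⟩ ⟨⟨g₁, g₁c, g₂c, g₂⟩, hs⟩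
    obtain ⟨gd, gl⟩ := (key s₁ s₂ g₁ g₁c g₂c g₂).1 hs
    have e₁ : s₁ = t₁ := le_antisymm
      (not_lt.1 (h.not_lt_of_common_tangent hb hba h₁ h₂c h₂ g₁c g₂c g₂ hl gd gl))
      (not_lt.1 (h.not_lt_of_common_tangent hb hba g₁ g₂c g₂ h₁c h₂c h₂ gl hd hl))
    have e₂ : s₂ = t₂ := h.strictMonoOn.injOn ⟨hc.1.trans g₂c, g₂⟩ ⟨hc.1.trans h₂c, h₂⟩ <|
      mul_left_cancel₀ hb.ne' (by rw [← gd, ← hd, e₁])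
    rw [e₁, e₂]
  · obtain ⟨hd', hl'⟩ := (key t₁ t₂ h₁ h₁c h₂c h₂).1 ⟨hd, hl⟩
    rw [h.deriv_kinked_left hc.2 h₁ h₁c]
    exact h.isConvexEnvelopeOn_kinked hb hba h₁ h₁c h₂c h₂ hd' hl'

end IsSlopeModel

section Quantile

variable {N G : ℝ → ℝ} {E : ℝ}

lemma strictMonoOn_of_comp_eq_exp (hN : StrictMono N) (hr : range N = Ioo 0 1)
    (hG : ∀ x, G (N x) = Real.exp x) : StrictMonoOn G (Ioo 0 1) := by
  rw [← hr]
  rintro _ ⟨x, rfl⟩ _ ⟨y, rfl⟩ hxy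
  rw [hG, hG]
  exact Real.exp_lt_exp.2 (hN.lt_iff_lt.1 hxy)

lemma pos_of_comp_eq_exp (hr : range N = Ioo 0 1) (hG : ∀ x, G (N x) = Real.exp x)
    {z : ℝ} (hz : z ∈ Ioo (0:ℝ) 1) : 0 < G z := by
  obtain ⟨x, rfl⟩ := hr.symm ▸ hz
  rw [hG]
  exact Real.exp_pos x

lemma continuousAt_of_comp_eq_exp (hN : StrictMono N) (hr : range N = Ioo 0 1)
    (hG : ∀ x, G (N x) = Real.exp x) {z : ℝ} (hz : z ∈ Ioo (0:ℝ) 1) : ContinuousAt G z := by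
  refine (strictMonoOn_of_comp_eq_exp hN hr hG).continuousAt_of_image_mem_nhds
    (isOpen_Ioo.mem_nhds hz) ?_
  have himg : G '' Ioo 0 1 = Ioi 0 := by
    rw [← hr, ← range_comp, ← Real.range_exp]
    exact congrArg range (funext hG)
  rw [himg]
  exact isOpen_Ioi.mem_nhds (pos_of_comp_eq_exp hr hG hz)

/-- The inverse on `[0,1]` of the normalized primitive of a reversed quantile function. -/
lemma isSlopeModel_invFunOn (hNc : Continuous N) (hN : StrictMono N) (hr : range N = Ioo 0 1)
    (hG : ∀ x, G (N x) = Real.exp x) (hint : IntegrableOn G (Ioo 0 1))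
    (hE : ∫ z in Ioo 0 1, G z = E) (hE0 : 0 < E) {W : ℝ → ℝ}
    (hW : ∀ s, W s = (∫ z in (0:ℝ)..s, G (1 - z)) / E) :
    StrictMonoOn W (Icc 0 1) ∧ BijOn W (Icc 0 1) (Icc 0 1) ∧
    IsSlopeModel (Function.invFunOn W (Icc 0 1))
      (fun t => E / G (1 - Function.invFunOn W (Icc 0 1) t))
      (fun m => W (1 - N (Real.log (E / m)))) := by
  have hflip : ∀ u ∈ Ioo (0:ℝ) 1, 1 - u ∈ Ioo (0:ℝ) 1 := fun u hu =>
    ⟨by linarith [hu.2], by linarith [hu.1]⟩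
  have hpos : ∀ u ∈ Ioo (0:ℝ) 1, 0 < G (1 - u) := fun u hu =>
    pos_of_comp_eq_exp hr hG (hflip u hu)
  have hGii : IntervalIntegrable G volume 0 1 := by
    rwa [intervalIntegrable_iff_integrableOn_Ioo_of_le zero_le_one]
  have hii : IntervalIntegrable (fun z => G (1 - z)) volume 0 1 := by
    simpa using (hGii.comp_sub_left 1).symm
  have hW' : W = fun s => (∫ z in (0:ℝ)..s, G (1 - z)) / E := funext hW
  have hW0 : W 0 = 0 := by simp [hW]
  have hW1 : W 1 = 1 := by
    rw [hW, intervalIntegral.integral_comp_sub_left (fun z => G z) 1, sub_self, sub_zero,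
      intervalIntegral.integral_of_le zero_le_one, integral_Ioc_eq_integral_Ioo, hE,
      div_self hE0.ne']
  have hWc : ContinuousOn W (Icc 0 1) := by
    rw [hW', ← uIcc_of_le zero_le_one]
    exact (intervalIntegral.continuousOn_primitive_interval' hii left_mem_uIcc).div_const E
  have hcontflip : ∀ u ∈ Ioo (0:ℝ) 1, ContinuousAt (fun z => G (1 - z)) u := fun u hu =>
    ContinuousAt.comp (f := fun z => 1 - z) (continuousAt_of_comp_eq_exp hN hr hG (hflip u hu))
      (by fun_prop)
  have hWd : ∀ u ∈ Ioo (0:ℝ) 1, HasDerivAt W (G (1 - u) / E) u := by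
    intro u hu
    rw [hW']
    refine (intervalIntegral.integral_hasDerivAt_right (hii.mono_set ?_) ?_
      (hcontflip u hu)).div_const E
    · rw [uIcc_of_le hu.1.le, uIcc_of_le zero_le_one]
      exact Icc_subset_Icc le_rfl hu.2.le
    · exact ContinuousAt.stronglyMeasurableAtFilter isOpen_Ioo hcontflip u hu
  have hWmono : StrictMonoOn W (Icc 0 1) := by
    refine strictMonoOn_of_deriv_pos (convex_Icc 0 1) hWc fun u hu => ?_
    rw [interior_Icc] at hu
    rw [(hWd u hu).deriv]
    exact div_pos (hpos u hu) hE0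
  have hmaps : MapsTo W (Icc 0 1) (Icc 0 1) := fun u hu => by
    have h0 := hWmono.monotoneOn (left_mem_Icc.2 zero_le_one) hu hu.1
    have h1 := hWmono.monotoneOn hu (right_mem_Icc.2 zero_le_one) hu.2
    rw [hW0] at h0
    rw [hW1] at h1
    exact ⟨h0, h1⟩
  have hsurj : SurjOn W (Icc 0 1) (Icc 0 1) := by
    have := intermediate_value_Icc zero_le_one hWc
    rwa [hW0, hW1] at this
  have hbij : BijOn W (Icc 0 1) (Icc 0 1) := ⟨hmaps, hWmono.injOn, hsurj⟩
  have hWIoo : ∀ u ∈ Ioo (0:ℝ) 1, W u ∈ Ioo (0:ℝ) 1 := fun u hu => by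
    have h0 := hWmono (left_mem_Icc.2 zero_le_one) (Ioo_subset_Icc_self hu) hu.1
    have h1 := hWmono (Ioo_subset_Icc_self hu) (right_mem_Icc.2 zero_le_one) hu.2
    rw [hW0] at h0
    rw [hW1] at h1
    exact ⟨h0, h1⟩
  refine ⟨hWmono, hbij, ?_⟩
  set v := Function.invFunOn W (Icc 0 1) with hv
  have hvmem : ∀ s ∈ Icc (0:ℝ) 1, v s ∈ Icc (0:ℝ) 1 := hsurj.mapsTo_invFunOn
  have hWv : ∀ s ∈ Icc (0:ℝ) 1, W (v s) = s := fun s hs => hsurj.rightInvOn_invFunOn hs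
  have hvW : ∀ u ∈ Icc (0:ℝ) 1, v (W u) = u := fun u hu => hWmono.injOn.leftInvOn_invFunOn hu
  have hvIoo : ∀ t ∈ Ioo (0:ℝ) 1, v t ∈ Ioo (0:ℝ) 1 := fun t ht => by
    have hti := Ioo_subset_Icc_self ht
    have hm := hvmem t hti
    have hw := hWv t hti
    refine ⟨hm.1.lt_of_ne fun h0 => ?_, hm.2.lt_of_ne fun h1 => ?_⟩
    · rw [← h0, hW0] at hw
      exact ht.1.ne hw
    · rw [h1, hW1] at hw
      exact ht.2.ne hw.symm
  have hvmono : StrictMonoOn v (Ioo 0 1) := fun x hx y hy hxy => by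
    have hxi := Ioo_subset_Icc_self hx
    have hyi := Ioo_subset_Icc_self hy
    rw [← hWmono.lt_iff_lt (hvmem x hxi) (hvmem y hyi), hWv x hxi, hWv y hyi]
    exact hxy
  have hvimg : v '' Ioo 0 1 = Ioo 0 1 := by
    refine Subset.antisymm (image_subset_iff.2 hvIoo) fun u hu => ?_
    exact ⟨W u, hWIoo u hu, hvW u (Ioo_subset_Icc_self hu)⟩
  have hqmem : ∀ x, 1 - N x ∈ Ioo (0:ℝ) 1 := fun x => hflip _ (hr ▸ mem_range_self x)
  refine ⟨fun t ht => ?_, fun t ht s hs hst => ?_, fun t ht => div_pos hE0 (hpos _ (hvIoo t ht)),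
    fun m _ => hWIoo _ (hqmem _), fun m hm => ?_, ?_⟩
  · have hc : ContinuousAt v t := hvmono.continuousAt_of_image_mem_nhds
      (isOpen_Ioo.mem_nhds ht) (hvimg.symm ▸ isOpen_Ioo.mem_nhds (hvIoo t ht))
    rw [← inv_div]
    refine HasDerivAt.of_local_left_inverse hc (hWd _ (hvIoo t ht))
      (div_pos (hpos _ (hvIoo t ht)) hE0).ne' ?_
    filter_upwards [isOpen_Ioo.mem_nhds ht] with y hy using hWv y (Ioo_subset_Icc_self hy)
  · have hu := hvIoo t ht
    have hu' := hvmem s hs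
    have hWt := hWv t (Ioo_subset_Icc_self ht)
    have hWs := hWv s hs
    have hGt := hpos _ hu
    have hvne : v s ≠ v t := fun heq => hst (by rw [← hWs, ← hWt, heq])
    suffices hsuff : E * (s - t) < G (1 - v t) * (v s - v t) by
      rw [div_mul_eq_mul_div, ← lt_sub_iff_add_lt', div_lt_iff₀ hGt]
      linarith
    have hanti : ∀ x ∈ Ioo (0:ℝ) 1, ∀ y ∈ Ioo (0:ℝ) 1, x < y → G (1 - y) < G (1 - x) :=
      fun x hx y hy hxy => strictMonoOn_of_comp_eq_exp hN hr hG (hflip y hy) (hflip x hx)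
        (by linarith)
    rcases hvne.lt_or_gt with hlt | hlt
    · obtain ⟨x, hx, hxe⟩ := exists_hasDerivAt_eq_slope W (fun x => G (1 - x) / E) hlt
        (hWc.mono (Icc_subset_Icc hu'.1 hu.2.le))
        (fun x hx => hWd x ⟨hu'.1.trans_lt hx.1, hx.2.trans hu.2⟩)
      have hcmp := hanti x ⟨hu'.1.trans_lt hx.1, hx.2.trans hu.2⟩ (v t) hu hx.2
      rw [hWt, hWs, div_eq_div_iff hE0.ne' (by linarith)] at hxe
      nlinarith
    · obtain ⟨x, hx, hxe⟩ := exists_hasDerivAt_eq_slope W (fun x => G (1 - x) / E) hlt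
        (hWc.mono (Icc_subset_Icc hu.1.le hu'.2))
        (fun x hx => hWd x ⟨hu.1.trans hx.1, hx.2.trans_le hu'.2⟩)
      have hcmp := hanti (v t) hu x ⟨hu.1.trans hx.1, hx.2.trans_le hu'.2⟩ hx.1
      rw [hWt, hWs, div_eq_div_iff hE0.ne' (by linarith)] at hxe
      nlinarith
  · have hEm : 0 < E / m := div_pos hE0 hm
    rw [hvW _ (Ioo_subset_Icc_self (hqmem _)), sub_sub_cancel, hG, Real.exp_log hEm]
    field_simp
  · refine hWc.comp (ContinuousOn.sub continuousOn_const (hNc.comp_continuousOn ?_))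
      fun m _ => Ioo_subset_Icc_self (hqmem _)
    exact ContinuousOn.log (continuousOn_const.div continuousOn_id fun m hm => ne_of_gt hm)
      fun m hm => (div_pos hE0 hm).ne'

end Quantile

section Cdf

variable (γ : Measure ℝ) [IsProbabilityMeasure γ]

lemma strictMono_cdf (hγ : volume ≪ γ) : StrictMono (cdf γ) := by
  intro x y hxy
  have hIoc : 0 < γ.real (Ioc x y) := by
    refine ENNReal.toReal_pos (fun h0 => ?_) (measure_ne_top _ _)
    have := hγ h0
    rw [Real.volume_Ioc, ENNReal.ofReal_eq_zero] at this
    linarith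
  rw [cdf_eq_real, cdf_eq_real, ← Iic_union_Ioc_eq_Iic hxy.le,
    measureReal_union (Iic_disjoint_Ioc le_rfl) measurableSet_Ioc]
  linarith

lemma continuous_cdf [NullSingletonClass γ] : Continuous (cdf γ) := by
  refine continuous_iff_continuousAt.2 fun x => ?_
  rw [(monotone_cdf γ).continuousAt_iff_leftLim_eq_rightLim, StieltjesFunction.rightLim_eq]
  have h := StieltjesFunction.measure_singleton (cdf γ) x
  rw [measure_cdf, measure_singleton, eq_comm, ENNReal.ofReal_eq_zero] at h
  exact le_antisymm ((monotone_cdf γ).leftLim_le le_rfl) (by linarith)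

lemma range_cdf [NullSingletonClass γ] (hγ : volume ≪ γ) : range (cdf γ) = Ioo 0 1 := by
  have hmono := strictMono_cdf γ hγ
  refine Subset.antisymm (range_subset_iff.2 fun x => ⟨?_, ?_⟩) fun z hz => ?_
  · exact (cdf_nonneg γ (x - 1)).trans_lt (hmono (by linarith))
  · exact (hmono (by linarith : x < x + 1)).trans_le (cdf_le_one γ _)
  · obtain ⟨a, ha⟩ := ((tendsto_cdf_atBot γ).eventually_lt_const hz.1).exists
    obtain ⟨b, hb⟩ := ((tendsto_cdf_atTop γ).eventually_const_lt hz.2).exists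
    exact mem_range_of_exists_le_of_exists_ge (continuous_cdf γ) ⟨a, ha.le⟩ ⟨b, hb.le⟩

lemma map_cdf_eq_restrict [NullSingletonClass γ] (hγ : volume ≪ γ) :
    γ.map (cdf γ) = volume.restrict (Ioo 0 1) := by
  have hmeas : Measurable (cdf γ) := (continuous_cdf γ).measurable
  have hIoo : ∀ x, cdf γ x ∈ Ioo (0:ℝ) 1 := fun x => range_cdf γ hγ ▸ mem_range_self x
  have := Measure.isProbabilityMeasure_map (μ := γ) hmeas.aemeasurable
  refine Measure.ext_of_Iic _ _ fun z => ?_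
  rw [Measure.map_apply hmeas measurableSet_Iic, Measure.restrict_apply measurableSet_Iic]
  rcases le_or_gt z 0 with hz | hz
  · have h₁ : cdf γ ⁻¹' Iic z = ∅ :=
      eq_empty_of_forall_notMem fun x hx => ((hIoo x).1.trans_le hx).not_ge hz
    have h₂ : Iic z ∩ Ioo (0:ℝ) 1 = ∅ :=
      eq_empty_of_forall_notMem fun x hx => (hx.2.1.trans_le hx.1).not_ge hz
    rw [h₁, h₂, measure_empty, measure_empty]
  rcases le_or_gt 1 z with hz₁ | hz₁
  · have h₁ : cdf γ ⁻¹' Iic z = univ := eq_univ_of_forall fun x => (hIoo x).2.le.trans hz₁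
    have h₂ : Iic z ∩ Ioo (0:ℝ) 1 = Ioo 0 1 :=
      inter_eq_right.2 fun x hx => hx.2.le.trans hz₁
    rw [h₁, h₂, measure_univ, Real.volume_Ioo]
    simp
  · obtain ⟨x, rfl⟩ : z ∈ range (cdf γ) := range_cdf γ hγ ▸ ⟨hz, hz₁⟩
    have h₁ : cdf γ ⁻¹' Iic (cdf γ x) = Iic x :=
      Set.ext fun y => (strictMono_cdf γ hγ).le_iff_le
    have h₂ : Iic (cdf γ x) ∩ Ioo (0:ℝ) 1 = Ioc 0 (cdf γ x) := by
      ext y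
      simp only [mem_inter_iff, mem_Iic, mem_Ioo, mem_Ioc]
      exact ⟨fun hy => ⟨hy.2.1, hy.1⟩, fun hy => ⟨hy.2, hy.1, hy.2.trans_lt hz₁⟩⟩
    rw [h₁, h₂, Real.volume_Ioc, sub_zero, ofReal_cdf]

end Cdf

lemma qf_cdf_map_log {Ω : Type*} [MeasurableSpace Ω] (μ : Measure Ω) [IsProbabilityMeasure μ]
    {ξ : Ω → ℝ} (hξm : Measurable ξ) (hξpos : ∀ ω, 0 < ξ ω)
    (hγ : volume ≪ μ.map (fun ω => Real.log (ξ ω))) (x : ℝ) :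
    qf μ ξ (cdf (μ.map (fun ω => Real.log (ξ ω))) x) = Real.exp x := by
  have hlogm : Measurable fun ω => Real.log (ξ ω) := hξm.log
  have := Measure.isProbabilityMeasure_map (μ := μ) hlogm.aemeasurable
  set γ := μ.map (fun ω => Real.log (ξ ω)) with hγdef
  have hset : {y : ℝ | cdf γ x < (μ {ω | ξ ω ≤ y}).toReal} = Ioi (Real.exp x) := by
    ext y
    simp only [mem_ofPred_eq, mem_Ioi]
    rcases le_or_gt y 0 with hy | hy
    · have hempty : {ω | ξ ω ≤ y} = ∅ :=
        eq_empty_of_forall_notMem fun ω hω => ((hξpos ω).trans_le hω).not_ge hy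
      rw [hempty, measure_empty, ENNReal.toReal_zero]
      exact iff_of_false (cdf_nonneg γ x).not_gt (hy.trans (Real.exp_pos x).le).not_gt
    · have hpre : {ω | ξ ω ≤ y} = (fun ω => Real.log (ξ ω)) ⁻¹' Iic (Real.log y) :=
        Set.ext fun ω => (Real.log_le_log_iff (hξpos ω) hy).symm
      rw [hpre, ← Measure.map_apply hlogm measurableSet_Iic, ← hγdef, ← measureReal_def,
        ← cdf_eq_real, (strictMono_cdf γ hγ).lt_iff_lt, Real.lt_log_iff_exp_lt hy]
  rw [qf, hset, csInf_Ioi]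

/-- for the ES distorted function there is a unique common-tangent pair
`0 < t₁ < w(α) < t₂ < 1`, and the convex envelope of `φ` equals `φ` outside `(t₁, t₂]`
and the common tangent line on `(t₁, t₂]`. -/
theorem ES_common_tangent_envelope
    {Ω : Type*} [MeasurableSpace Ω] (μ : Measure Ω) [IsProbabilityMeasure μ]
    (ξ : Ω → ℝ) (hξm : Measurable ξ) (hξpos : ∀ ω, 0 < ξ ω) (hξint : Integrable ξ μ)
    (T r θ : ℝ) (hT : 0 < T) (hr : 0 < r) (hθ : 0 < θ)
    (hlog : μ.map (fun ω => Real.log (ξ ω))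
      = gaussianReal (-(r + θ ^ 2 / 2) * T) ((θ ^ 2 * T).toNNReal))
    (α lam : ℝ) (hα : α ∈ Set.Ioo (0:ℝ) 1) (hlam : 0 < lam) :
    (∃! p : ℝ × ℝ,
      (0 < p.1 ∧ p.1 < wDist μ ξ α ∧ wDist μ ξ α < p.2 ∧ p.2 < 1) ∧
        deriv (phiES μ ξ α lam) p.1 = deriv (phiES μ ξ α lam) p.2 ∧
        deriv (phiES μ ξ α lam) p.1
          = (phiES μ ξ α lam p.2 - phiES μ ξ α lam p.1) / (p.2 - p.1)) ∧
    ∀ t₁ t₂ : ℝ, 0 < t₁ → t₁ < wDist μ ξ α → wDist μ ξ α < t₂ → t₂ < 1 →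
      deriv (phiES μ ξ α lam) t₁ = deriv (phiES μ ξ α lam) t₂ →
      deriv (phiES μ ξ α lam) t₁
        = (phiES μ ξ α lam t₂ - phiES μ ξ α lam t₁) / (t₂ - t₁) →
      IsConvexEnvelopeOn (Set.Icc 0 1) (phiES μ ξ α lam)
        (fun s => if s ≤ t₁ then phiES μ ξ α lam s
          else if s ≤ t₂ then phiES μ ξ α lam t₁ + deriv (phiES μ ξ α lam) t₁ * (s - t₁)
          else phiES μ ξ α lam s) := by
  set γ := μ.map (fun ω => Real.log (ξ ω)) with hγdef
  have hV : (θ ^ 2 * T).toNNReal ≠ 0 := by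
    have : 0 < θ ^ 2 * T := by positivity
    simpa using this
  have hγac : volume ≪ γ := hlog ▸ gaussianReal_absolutelyContinuous' _ hV
  have hlogm : Measurable fun ω => Real.log (ξ ω) := hξm.log
  have : IsProbabilityMeasure γ := Measure.isProbabilityMeasure_map hlogm.aemeasurable
  have : NullSingletonClass γ := hlog ▸ nullSingletonClass_gaussianReal hV
  have hN := strictMono_cdf γ hγac
  have hr := range_cdf γ hγac
  have hG : ∀ x, qf μ ξ (cdf γ x) = Real.exp x := qf_cdf_map_log μ hξm hξpos hγac
  have hNm : Measurable (cdf γ) := (continuous_cdf γ).measurable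
  have hGsm : AEStronglyMeasurable (qf μ ξ) (volume.restrict (Ioo 0 1)) :=
    ContinuousOn.aestronglyMeasurable
      (fun z hz => (continuousAt_of_comp_eq_exp hN hr hG hz).continuousWithinAt) measurableSet_Ioo
  have hcomp : qf μ ξ ∘ cdf γ = Real.exp := funext hG
  have hexplog : (fun ω => Real.exp (Real.log (ξ ω))) = ξ :=
    funext fun ω => Real.exp_log (hξpos ω)
  have hexpsm : AEStronglyMeasurable Real.exp γ := Real.continuous_exp.aestronglyMeasurable
  have hint : IntegrableOn (qf μ ξ) (Ioo 0 1) := by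
    rw [IntegrableOn, ← map_cdf_eq_restrict γ hγac,
      integrable_map_measure (by rwa [map_cdf_eq_restrict γ hγac]) hNm.aemeasurable, hcomp, hγdef,
      integrable_map_measure hexpsm hlogm.aemeasurable]
    exact hξint.congr (ae_of_all μ fun ω => (Real.exp_log (hξpos ω)).symm)
  have hE : ∫ z in Ioo 0 1, qf μ ξ z = ∫ ω, ξ ω ∂μ := by
    rw [← map_cdf_eq_restrict γ hγac,
      integral_map hNm.aemeasurable (by rwa [map_cdf_eq_restrict γ hγac])]
    simp only [hG]
    rw [hγdef, integral_map hlogm.aemeasurable hexpsm, hexplog]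
  have hE0 : 0 < ∫ ω, ξ ω ∂μ := by
    rw [integral_pos_iff_support_of_nonneg (fun ω => (hξpos ω).le) hξint,
      (Function.support_eq_univ fun ω => (hξpos ω).ne'), measure_univ]
    exact one_pos
  obtain ⟨hWmono, hWbij, hmodel⟩ := isSlopeModel_invFunOn (W := wDist μ ξ) (continuous_cdf γ) hN hr
    hG hint hE hE0 fun s => rfl
  have hαi := Ioo_subset_Icc_self hα
  have hc : wDist μ ξ α ∈ Ioo (0:ℝ) 1 := by
    refine ⟨(hWbij.mapsTo (left_mem_Icc.2 zero_le_one)).1.trans_lt ?_,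
      lt_of_lt_of_le ?_ (hWbij.mapsTo (right_mem_Icc.2 zero_le_one)).2⟩
    · exact hWmono (left_mem_Icc.2 zero_le_one) hαi hα.1
    · exact hWmono hαi (right_mem_Icc.2 zero_le_one) hα.2
  have hvc : wInv μ ξ (wDist μ ξ α) = α := hWmono.injOn.leftInvOn_invFunOn hαi
  have hα0 : 0 < α := hα.1
  have hphi : phiES μ ξ α lam = kinked (wInv μ ξ) ((1 / α + lam) / (1 + lam)) (lam / (1 + lam))
      (1 / (1 + lam)) (wDist μ ξ α) := by
    funext s
    simp only [phiES, kinked]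
    split_ifs <;> ring
  rw [hphi]
  refine hmodel.existsUnique_common_tangent_and_envelope (by positivity) ?_ hc ?_
  · have : 0 < 1 / α := by positivity
    gcongr
    linarith
  · change _ * wInv μ ξ _ = _ * wInv μ ξ _ + _
    rw [hvc]
    field_simp
    ring

end
end
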